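/- For ρ = (σ,τ) ∈ Σ_N², let f₁(ρ) = σ_N·τ_N·R⁻(σ,τ). There is a universal constant K > 0 such that for all N ≥ 1, all β ∈ (0,1], and all t, s ∈ [0,1], |∂³/∂s³ E⟨f₁⟩_{t,s}| ≤ K·E⟨R(σ¹,σ²)⁴⟩, where ⟨·⟩ is the Gibbs average of the original single SK system at inverse temperature β. -/

import Mathlib

open MeasureTheory ProbabilityTheory Real Finset Filter

noncomputable section

/-- Spin configurations: each of the `N` sites carries a `±1` spin, encoded by a `Bool`. -/
abbrev Config (N : ℕ) := Fin N → Bool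

/-- The `±1` value of a spin. -/
def spin (b : Bool) : ℝ := if b then 1 else -1

/-- The value of the last spin `σ_N` (junk value `0` when `N = 0`). -/
def spinLast {N : ℕ} (σ : Config N) : ℝ :=
  if h : 0 < N then spin (σ ⟨N - 1, Nat.sub_lt h Nat.one_pos⟩) else 0

/-- The Gaussian disorder: i.i.d. standard Gaussians indexed by pairs `(i, j)`
(only the entries with `i < j` are used). -/
def gaussPi (N : ℕ) : Measure (Fin N × Fin N → ℝ) :=
  Measure.pi fun _ => gaussianReal 0 1

instance (N : ℕ) : IsProbabilityMeasure (gaussPi N) := by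
  unfold gaussPi; infer_instance

/-- Three independent copies `g, g', g''` of the disorder. -/
def disM3 (N : ℕ) :
    Measure ((Fin N × Fin N → ℝ) × (Fin N × Fin N → ℝ) × (Fin N × Fin N → ℝ)) :=
  (gaussPi N).prod ((gaussPi N).prod (gaussPi N))

/-- The SK Hamiltonian `H_{N,β}(σ) = (β/√N) ∑_{i<j} g_{ij} σ_i σ_j`. -/
def ham (N : ℕ) (β : ℝ) (g : Fin N × Fin N → ℝ) (σ : Config N) : ℝ :=
  (β / Real.sqrt N) *
    ∑ p ∈ Finset.univ.filter (fun p : Fin N × Fin N => p.1 < p.2),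
      g p * spin (σ p.1) * spin (σ p.2)

/-- The cavity Hamiltonian `H⁻_N(σ) = (β/√N) ∑_{i<j<N} g_{ij} σ_i σ_j` on the first
`N - 1` spins. -/
def hamCav (N : ℕ) (β : ℝ) (g : Fin N × Fin N → ℝ) (σ : Config N) : ℝ :=
  (β / Real.sqrt N) *
    ∑ p ∈ Finset.univ.filter
        (fun p : Fin N × Fin N => p.1 < p.2 ∧ (p.2 : ℕ) < N - 1),
      g p * spin (σ p.1) * spin (σ p.2)

/-- The overlap `R(σ¹,σ²) = (1/N) ∑_{i ≤ N} σ_i¹ σ_i²`. -/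
def ovlp (N : ℕ) (σ τ : Config N) : ℝ := (∑ i, spin (σ i) * spin (τ i)) / N

/-- The truncated overlap `R⁻(σ¹,σ²) = (1/N) ∑_{i ≤ N−1} σ_i¹ σ_i²`. -/
def ovlpm (N : ℕ) (σ τ : Config N) : ℝ :=
  (∑ i ∈ Finset.univ.filter (fun i : Fin N => (i : ℕ) < N - 1),
    spin (σ i) * spin (τ i)) / N

/-- The partition function `Z_N(β)`. -/
def partFun (N : ℕ) (β : ℝ) (g : Fin N × Fin N → ℝ) : ℝ :=
  ∑ σ : Config N, Real.exp (ham N β g σ)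

/-- The free energy `F_N(β) = ln Z_N(β)`. -/
def freeEnergy (N : ℕ) (β : ℝ) (g : Fin N × Fin N → ℝ) : ℝ :=
  Real.log (partFun N β g)

/-- Two-replica Gibbs average `⟨f⟩` for the single SK system. -/
def gibbs2 (N : ℕ) (β : ℝ) (g : Fin N × Fin N → ℝ)
    (f : Config N → Config N → ℝ) : ℝ :=
  (∑ σ : Config N, ∑ τ : Config N,
    f σ τ * Real.exp (ham N β g σ + ham N β g τ)) / (partFun N β g) ^ 2

/-- Disorder expectation of the two-replica Gibbs average. -/
def Egibbs2 (N : ℕ) (β : ℝ) (f : Config N → Config N → ℝ) : ℝ :=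
  ∫ g, gibbs2 N β g f ∂gaussPi N

/-- The interpolated Hamiltonian `√t · H_N + √(1−t) · H'_N`. -/
def hamT (N : ℕ) (β t : ℝ) (g g' : Fin N × Fin N → ℝ) (σ : Config N) : ℝ :=
  Real.sqrt t * ham N β g σ + Real.sqrt (1 - t) * ham N β g' σ

/-- The coupled Gibbs weight `exp(H¹_{N,t}(σ) + H²_{N,t}(τ))`. -/
def wT (N : ℕ) (β t : ℝ) (g g' g'' : Fin N × Fin N → ℝ)
    (ρ : Config N × Config N) : ℝ :=
  Real.exp (hamT N β t g g' ρ.1 + hamT N β t g g'' ρ.2)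

/-- The coupled Gibbs average `⟨f⟩_t` of a function of one pair `(σ, τ)`. -/
def gibbsT (N : ℕ) (β t : ℝ) (g g' g'' : Fin N × Fin N → ℝ)
    (f : Config N × Config N → ℝ) : ℝ :=
  (∑ ρ : Config N × Config N, f ρ * wT N β t g g' g'' ρ) /
    (∑ ρ : Config N × Config N, wT N β t g g' g'' ρ)

/-- The coupled Gibbs average `⟨f⟩_t` of a function of two pairs. -/
def gibbsT2 (N : ℕ) (β t : ℝ) (g g' g'' : Fin N × Fin N → ℝ)
    (f : Config N × Config N → Config N × Config N → ℝ) : ℝ :=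
  (∑ ρ₁ : Config N × Config N, ∑ ρ₂ : Config N × Config N,
    f ρ₁ ρ₂ * wT N β t g g' g'' ρ₁ * wT N β t g g' g'' ρ₂) /
    (∑ ρ : Config N × Config N, wT N β t g g' g'' ρ) ^ 2

/-- Disorder expectation `E⟨f⟩_t` (one pair). -/
def EgibbsT (N : ℕ) (β t : ℝ) (f : Config N × Config N → ℝ) : ℝ :=
  ∫ ω, gibbsT N β t ω.1 ω.2.1 ω.2.2 f ∂disM3 N

/-- Disorder expectation `E⟨f⟩_t` (two pairs). -/
def EgibbsT2 (N : ℕ) (β t : ℝ)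
    (f : Config N × Config N → Config N × Config N → ℝ) : ℝ :=
  ∫ ω, gibbsT2 N β t ω.1 ω.2.1 ω.2.2 f ∂disM3 N

/-- The `s`-dependent cavity field term
`(β/√N) σ_N ∑_{i<N} (√t g_{iN} + √(1−t) g'_{iN}) σ_i`. -/
def cavField (N : ℕ) (β t : ℝ) (g g' : Fin N × Fin N → ℝ) (σ : Config N) : ℝ :=
  if h : 0 < N then
    (β / Real.sqrt N) * spin (σ ⟨N - 1, Nat.sub_lt h Nat.one_pos⟩) *
      ∑ i ∈ Finset.univ.filter (fun i : Fin N => (i : ℕ) < N - 1),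
        (Real.sqrt t * g (i, ⟨N - 1, Nat.sub_lt h Nat.one_pos⟩) +
          Real.sqrt (1 - t) * g' (i, ⟨N - 1, Nat.sub_lt h Nat.one_pos⟩)) * spin (σ i)
  else 0

/-- The cavity-interpolated Hamiltonian `H^1_{N,t,s}` (resp. `H^2_{N,t,s}` with `g''`). -/
def hamTS (N : ℕ) (β t s : ℝ) (g g' : Fin N × Fin N → ℝ) (σ : Config N) : ℝ :=
  Real.sqrt t * hamCav N β g σ + Real.sqrt (1 - t) * hamCav N β g' σ +
    Real.sqrt s * cavField N β t g g' σ

/-- The coupled cavity Gibbs weight `exp(H¹_{N,t,s}(σ) + H²_{N,t,s}(τ))`. -/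
def wTS (N : ℕ) (β t s : ℝ) (g g' g'' : Fin N × Fin N → ℝ)
    (ρ : Config N × Config N) : ℝ :=
  Real.exp (hamTS N β t s g g' ρ.1 + hamTS N β t s g g'' ρ.2)

/-- The coupled cavity Gibbs average `⟨f⟩_{t,s}` of a function of one pair. -/
def gibbsTS1 (N : ℕ) (β t s : ℝ) (g g' g'' : Fin N × Fin N → ℝ)
    (f : Config N × Config N → ℝ) : ℝ :=
  (∑ ρ : Config N × Config N, f ρ * wTS N β t s g g' g'' ρ) /
    (∑ ρ : Config N × Config N, wTS N β t s g g' g'' ρ)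

/-- The coupled cavity Gibbs average `⟨f⟩_{t,s}` of a function of two pairs. -/
def gibbsTS2 (N : ℕ) (β t s : ℝ) (g g' g'' : Fin N × Fin N → ℝ)
    (f : Config N × Config N → Config N × Config N → ℝ) : ℝ :=
  (∑ ρ₁ : Config N × Config N, ∑ ρ₂ : Config N × Config N,
    f ρ₁ ρ₂ * wTS N β t s g g' g'' ρ₁ * wTS N β t s g g' g'' ρ₂) /
    (∑ ρ : Config N × Config N, wTS N β t s g g' g'' ρ) ^ 2

/-- The coupled cavity Gibbs average `⟨f⟩_{t,s}` of a function of `n` pairs. -/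
def gibbsTSn (N : ℕ) (β t s : ℝ) (g g' g'' : Fin N × Fin N → ℝ) {n : ℕ}
    (f : (Fin n → Config N × Config N) → ℝ) : ℝ :=
  (∑ ρ : Fin n → Config N × Config N, f ρ * ∏ l, wTS N β t s g g' g'' (ρ l)) /
    (∑ ρ₀ : Config N × Config N, wTS N β t s g g' g'' ρ₀) ^ n

/-- Disorder expectation `E⟨f⟩_{t,s}` (one pair). -/
def EgibbsTS1 (N : ℕ) (β t s : ℝ) (f : Config N × Config N → ℝ) : ℝ :=
  ∫ ω, gibbsTS1 N β t s ω.1 ω.2.1 ω.2.2 f ∂disM3 N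

/-- Disorder expectation `E⟨f⟩_{t,s}` (two pairs). -/
def EgibbsTS2 (N : ℕ) (β t s : ℝ)
    (f : Config N × Config N → Config N × Config N → ℝ) : ℝ :=
  ∫ ω, gibbsTS2 N β t s ω.1 ω.2.1 ω.2.2 f ∂disM3 N

/-- Disorder expectation `E⟨f⟩_{t,s}` (`n` pairs). -/
def EgibbsTSn (N : ℕ) (β t s : ℝ) {n : ℕ}
    (f : (Fin n → Config N × Config N) → ℝ) : ℝ :=
  ∫ ω, gibbsTSn N β t s ω.1 ω.2.1 ω.2.2 f ∂disM3 N

/-- The covariance kernel `U(ρ, ρ')` of the `s`-part of the coupled cavity Hamiltonians. -/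
def Ufun (N : ℕ) (β t : ℝ) (ρ ρ' : Config N × Config N) : ℝ :=
  β ^ 2 / 2 * (spinLast ρ.1 * spinLast ρ'.1 * ovlpm N ρ.1 ρ'.1 +
      spinLast ρ.2 * spinLast ρ'.2 * ovlpm N ρ.2 ρ'.2) +
    β ^ 2 * t / 2 * (spinLast ρ.1 * spinLast ρ'.2 * ovlpm N ρ.1 ρ'.2 +
      spinLast ρ.2 * spinLast ρ'.1 * ovlpm N ρ.2 ρ'.1)

/-- `ν(β) = −(1/2)·ln(1 − β²) − β²/2`. -/
def nuSK (b : ℝ) : ℝ := -(1 / 2) * Real.log (1 - b ^ 2) - b ^ 2 / 2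

/-- Stein's identity for a standard Gaussian variable. -/
lemma integral_mul_gaussianReal_eq_integral_deriv {F F' : ℝ → ℝ} {a b : ℝ}
    (hF : ∀ x, HasDerivAt F (F' x) x) (hF' : Measurable F')
    (hFa : ∀ x, |F x| ≤ a) (hFb : ∀ x, |F' x| ≤ b) :
    ∫ x, x * F x ∂gaussianReal 0 1 = ∫ x, F' x ∂gaussianReal 0 1 := by
  have hcont : Continuous F := continuous_iff_continuousAt.2 fun x => (hF x).continuousAt
  have hpdf : ∀ x, HasDerivAt (gaussianPDFReal 0 1) (-x * gaussianPDFReal 0 1 x) x := by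
    intro x
    unfold gaussianPDFReal
    have h : HasDerivAt (fun x : ℝ => -(x - 0) ^ 2 / (2 * ((1 : NNReal) : ℝ))) (-x) x := by
      have := (((hasDerivAt_id x).sub_const 0).pow 2).neg.div_const (2 * ((1 : NNReal) : ℝ))
      refine this.congr_deriv ?_
      simp; ring
    refine (h.exp.const_mul _).congr_deriv ?_
    ring
  have hgauss : Integrable (gaussianPDFReal 0 1) := integrable_gaussianPDFReal 0 1
  have hxint : Integrable fun x : ℝ => gaussianPDFReal 0 1 x * x := by
    have h1 : Integrable (id : ℝ → ℝ) (gaussianReal 0 1) :=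
      (memLp_id_gaussianReal 1).integrable (by simp)
    rw [gaussianReal_of_var_ne_zero _ one_ne_zero] at h1
    unfold gaussianPDF at h1
    rw [integrable_withDensity_iff_integrable_smul₀' (by fun_prop) (by simp)] at h1
    refine h1.congr (ae_of_all _ fun x => ?_)
    simp [ENNReal.toReal_ofReal, gaussianPDFReal_nonneg]
  have key := integral_mul_deriv_eq_deriv_mul_of_integrable (u := F) (u' := F')
    (v := gaussianPDFReal 0 1) (v' := fun x => -x * gaussianPDFReal 0 1 x)
    (fun x _ => hF x) (fun x _ => hpdf x) ?_ ?_ ?_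
  · rw [integral_gaussianReal_eq_integral_smul one_ne_zero,
      integral_gaussianReal_eq_integral_smul one_ne_zero]
    simp only [smul_eq_mul]
    calc ∫ x, gaussianPDFReal 0 1 x * (x * F x)
        = -∫ x, F x * (-x * gaussianPDFReal 0 1 x) := by
          rw [← integral_neg]; congr 1; ext x; ring
      _ = ∫ x, gaussianPDFReal 0 1 x * F' x := by
          rw [key, neg_neg]; congr 1; ext x; ring
  · have h := hxint.neg.bdd_mul (c := a) hcont.aestronglyMeasurable (ae_of_all _ hFa)
    refine h.congr (ae_of_all _ fun x => ?_)
    simp only [Pi.neg_apply, Pi.mul_apply]; ring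
  · exact hgauss.bdd_mul (c := b) hF'.aestronglyMeasurable (ae_of_all _ hFb)
  · exact hgauss.bdd_mul (c := a) hcont.aestronglyMeasurable (ae_of_all _ hFa)

/-- Resampling one coordinate preserves a product probability measure. -/
lemma measurePreserving_update_pi {ι : Type*} [Fintype ι] [DecidableEq ι] (μ : ι → Measure ℝ)
    [∀ i, IsProbabilityMeasure (μ i)] (k : ι) :
    MeasurePreserving (fun z : (ι → ℝ) × ℝ => Function.update z.1 k z.2)
      ((Measure.pi μ).prod (μ k)) (Measure.pi μ) := by
  have hm : Measurable fun z : (ι → ℝ) × ℝ => Function.update z.1 k z.2 := by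
    refine measurable_pi_iff.2 fun i => ?_
    by_cases h : i = k
    · subst h; simpa using measurable_snd
    · simp only [Function.update_of_ne h]; fun_prop
  refine ⟨hm, ?_⟩
  symm
  refine Measure.pi_eq fun s hs => ?_
  rw [Measure.map_apply hm (MeasurableSet.univ_pi hs)]
  have hpre : (fun z : (ι → ℝ) × ℝ => Function.update z.1 k z.2) ⁻¹' Set.univ.pi s =
      (Set.univ.pi (Function.update s k Set.univ)) ×ˢ s k := by
    ext z
    simp only [Set.mem_preimage, Set.mem_univ_pi, Set.mem_prod]
    constructor
    · intro h
      refine ⟨fun i => ?_, by simpa using h k⟩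
      by_cases hi : i = k
      · subst hi; simp
      · simpa [Function.update_of_ne hi] using h i
    · rintro ⟨h1, h2⟩ i
      by_cases hi : i = k
      · subst hi; simpa using h2
      · simpa [Function.update_of_ne hi] using h1 i
  rw [hpre, Measure.prod_prod, Measure.pi_pi, ← Finset.mul_prod_erase _ _ (Finset.mem_univ k),
    ← Finset.mul_prod_erase (Finset.univ) (fun i => μ i (s i)) (Finset.mem_univ k)]
  simp only [Function.update_self, measure_univ, one_mul]
  rw [mul_comm]
  congr 1
  refine Finset.prod_congr rfl fun i hi => ?_
  rw [Function.update_of_ne (Finset.ne_of_mem_erase hi)]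

lemma integrable_coord {ι : Type*} [Fintype ι] (k : ι) :
    Integrable (fun g : ι → ℝ => g k) (Measure.pi (fun _ : ι => gaussianReal 0 1)) :=
  (measurePreserving_eval (fun _ : ι => gaussianReal 0 1) k).integrable_comp_of_integrable
    ((memLp_id_gaussianReal 1).integrable (by simp))

/-- Gaussian integration by parts for a bounded function of finitely many independent
standard Gaussians. -/
lemma integral_coord_mul_pi_gaussianReal {ι : Type*} [Fintype ι] [DecidableEq ι] (k : ι)
    {F F' : (ι → ℝ) → ℝ} {a b : ℝ} (hFm : Measurable F) (hF'm : Measurable F')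
    (hF : ∀ x y, HasDerivAt (fun y => F (Function.update x k y)) (F' (Function.update x k y)) y)
    (hFa : ∀ x, |F x| ≤ a) (hFb : ∀ x, |F' x| ≤ b) :
    ∫ x, x k * F x ∂Measure.pi (fun _ : ι => gaussianReal 0 1) =
      ∫ x, F' x ∂Measure.pi (fun _ : ι => gaussianReal 0 1) := by
  have hmp := measurePreserving_update_pi (fun _ : ι => gaussianReal 0 1) k
  have hi1 : Integrable (fun x : ι → ℝ => x k * F x)
      (Measure.pi (fun _ : ι => gaussianReal 0 1)) :=
    (integrable_coord k).mul_bdd (c := a) hFm.aestronglyMeasurable (ae_of_all _ hFa)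
  have hi2 : Integrable F' (Measure.pi (fun _ : ι => gaussianReal 0 1)) :=
    Integrable.of_bound hF'm.aestronglyMeasurable b (ae_of_all _ hFb)
  have hj1 : Integrable (fun z : (ι → ℝ) × ℝ =>
      Function.update z.1 k z.2 k * F (Function.update z.1 k z.2))
      ((Measure.pi (fun _ : ι => gaussianReal 0 1)).prod (gaussianReal 0 1)) :=
    hmp.integrable_comp_of_integrable hi1
  have hj2 : Integrable (fun z : (ι → ℝ) × ℝ => F' (Function.update z.1 k z.2))
      ((Measure.pi (fun _ : ι => gaussianReal 0 1)).prod (gaussianReal 0 1)) :=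
    hmp.integrable_comp_of_integrable hi2
  conv_lhs => rw [← hmp.map_eq]
  conv_rhs => rw [← hmp.map_eq]
  rw [integral_map hmp.measurable.aemeasurable
      (by rw [hmp.map_eq]; exact hi1.aestronglyMeasurable),
    integral_map hmp.measurable.aemeasurable (by rw [hmp.map_eq]; exact hi2.aestronglyMeasurable),
    integral_prod _ hj1, integral_prod _ hj2]
  congr 1
  ext x
  simp only [Function.update_self]
  exact integral_mul_gaussianReal_eq_integral_deriv (hF x)
    (hF'm.comp (measurable_update x)) (fun y => hFa _) (fun y => hFb _)

/-- The Gibbs probability of a configuration for the (exponent) Hamiltonian `H`. -/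
def gibbsProb {S : Type*} [Fintype S] (H : S → ℝ) (ρ : S) : ℝ :=
  Real.exp (H ρ) / ∑ ρ', Real.exp (H ρ')

/-- The average of a function of `n` independent replicas, each with law `p`. -/
def replicaAvg {S : Type*} [Fintype S] (p : S → ℝ) {n : ℕ} (f : (Fin n → S) → ℝ) : ℝ :=
  ∑ ρ, f ρ * ∏ l, p (ρ l)

/-- The function of `n + 1` replicas (the new one having index `0`) whose average is the
derivative of the average of `f` when the Hamiltonian is perturbed in the direction `a`. -/
def replicaDiff {S : Type*} (a : S → ℝ) {n : ℕ} (f : (Fin n → S) → ℝ) :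
    (Fin (n + 1) → S) → ℝ :=
  fun ρ => f (Fin.tail ρ) * ∑ l : Fin n, (a (ρ l.succ) - a (ρ 0))

section Replicas

variable {S : Type*} [Fintype S]

lemma gibbsProb_nonneg (H : S → ℝ) (ρ : S) : 0 ≤ gibbsProb H ρ := by
  unfold gibbsProb; positivity

lemma sum_exp_pos [Nonempty S] (H : S → ℝ) : 0 < ∑ ρ, Real.exp (H ρ) :=
  Finset.sum_pos (fun _ _ => Real.exp_pos _) Finset.univ_nonempty

lemma sum_gibbsProb [Nonempty S] (H : S → ℝ) : ∑ ρ, gibbsProb H ρ = 1 := by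
  unfold gibbsProb
  rw [← Finset.sum_div, div_self (sum_exp_pos H).ne']

lemma hasDerivAt_gibbsProb [Nonempty S] {H : ℝ → S → ℝ} {a : S → ℝ} {x : ℝ}
    (hH : ∀ ρ, HasDerivAt (fun x => H x ρ) (a ρ) x) (ρ : S) :
    HasDerivAt (fun x => gibbsProb (H x) ρ)
      (gibbsProb (H x) ρ * (a ρ - ∑ ρ', gibbsProb (H x) ρ' * a ρ')) x := by
  have h1 := (hH ρ).exp
  have h2 : HasDerivAt (fun x => ∑ ρ', Real.exp (H x ρ')) (∑ ρ', Real.exp (H x ρ') * a ρ') x :=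
    HasDerivAt.fun_sum fun ρ' _ => (hH ρ').exp
  have hZ := (sum_exp_pos (H x)).ne'
  refine (h1.div h2 hZ).congr_deriv ?_
  have h3 : ∑ ρ', gibbsProb (H x) ρ' * a ρ' =
      (∑ ρ', Real.exp (H x ρ') * a ρ') / ∑ ρ', Real.exp (H x ρ') := by
    rw [Finset.sum_div]
    refine Finset.sum_congr rfl fun ρ' _ => ?_
    unfold gibbsProb; ring
  rw [h3]
  unfold gibbsProb
  field_simp

lemma sum_fin_succ_fun {n : ℕ} (F : (Fin (n + 1) → S) → ℝ) :
    ∑ ρ, F ρ = ∑ x : S, ∑ ρ : Fin n → S, F (Fin.cons x ρ) := by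
  rw [← Fintype.sum_prod_type', ← (Fin.consEquiv fun _ : Fin (n + 1) => S).sum_comp]
  rfl

lemma replicaAvg_tail {p : S → ℝ} (hp : ∑ x, p x = 1) {n : ℕ} (f : (Fin n → S) → ℝ) :
    replicaAvg p (fun ρ : Fin (n + 1) → S => f (Fin.tail ρ)) = replicaAvg p f := by
  unfold replicaAvg
  rw [sum_fin_succ_fun]
  simp only [Fin.tail_cons, Fin.prod_univ_succ, Fin.cons_zero, Fin.cons_succ]
  rw [Finset.sum_comm]
  refine Finset.sum_congr rfl fun ρ _ => ?_
  calc ∑ x, f ρ * (p x * ∏ l, p (ρ l)) = (∑ x, p x) * (f ρ * ∏ l, p (ρ l)) := by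
        rw [Finset.sum_mul]; exact Finset.sum_congr rfl fun x _ => by ring
    _ = _ := by rw [hp, one_mul]

lemma replicaAvg_mono {p : S → ℝ} (hp : ∀ x, 0 ≤ p x) {n : ℕ} {f h : (Fin n → S) → ℝ}
    (hfh : ∀ ρ, f ρ ≤ h ρ) : replicaAvg p f ≤ replicaAvg p h :=
  Finset.sum_le_sum fun ρ _ =>
    mul_le_mul_of_nonneg_right (hfh ρ) (Finset.prod_nonneg fun _ _ => hp _)

lemma replicaAvg_prod {p : S → ℝ} {n : ℕ} (F : Fin n → S → ℝ) :
    replicaAvg p (fun ρ => ∏ l, F l (ρ l)) = ∏ l, ∑ x, F l x * p x := by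
  unfold replicaAvg
  rw [Fintype.prod_sum]
  simp only [Finset.prod_mul_distrib]

lemma replicaAvg_const {p : S → ℝ} (hp : ∑ x, p x = 1) {n : ℕ} (c : ℝ) :
    replicaAvg p (fun _ : Fin n → S => c) = c := by
  have := replicaAvg_prod (p := p) (n := n) (fun _ _ => (1 : ℝ))
  simp only [Finset.prod_const_one, one_mul, hp] at this
  unfold replicaAvg at this ⊢
  simp only [one_mul] at this
  rw [← Finset.mul_sum, this, mul_one]

lemma replicaAvg_const_mul (p : S → ℝ) {n : ℕ} (c : ℝ) (f : (Fin n → S) → ℝ) :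
    replicaAvg p (fun ρ => c * f ρ) = c * replicaAvg p f := by
  unfold replicaAvg
  rw [Finset.mul_sum]
  exact Finset.sum_congr rfl fun _ _ => by ring

lemma replicaAvg_sum (p : S → ℝ) {n : ℕ} {κ : Type*} (s : Finset κ)
    (f : κ → (Fin n → S) → ℝ) :
    replicaAvg p (fun ρ => ∑ k ∈ s, f k ρ) = ∑ k ∈ s, replicaAvg p (f k) := by
  unfold replicaAvg
  rw [Finset.sum_comm]
  exact Finset.sum_congr rfl fun _ _ => Finset.sum_mul _ _ _

lemma abs_replicaAvg_le {p : S → ℝ} (hp : ∀ x, 0 ≤ p x) {n : ℕ} (f : (Fin n → S) → ℝ) :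
    |replicaAvg p f| ≤ replicaAvg p (fun ρ => |f ρ|) := by
  refine (Finset.abs_sum_le_sum_abs _ _).trans (Finset.sum_le_sum fun ρ _ => ?_)
  rw [abs_mul, abs_of_nonneg (Finset.prod_nonneg fun _ _ => hp _)]

lemma abs_replicaAvg_le_sum {p : S → ℝ} (hp : ∀ x, 0 ≤ p x) (hp1 : ∑ x, p x = 1) {n : ℕ}
    (f : (Fin n → S) → ℝ) : |replicaAvg p f| ≤ ∑ ρ, |f ρ| := by
  refine (abs_replicaAvg_le hp f).trans ?_
  rw [← replicaAvg_const hp1 (n := n) (∑ ρ, |f ρ|)]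
  exact replicaAvg_mono hp fun ρ =>
    Finset.single_le_sum (f := fun ρ => |f ρ|) (fun _ _ => abs_nonneg _) (Finset.mem_univ ρ)

/-- Differentiating a replicated Gibbs average adds one replica. -/
lemma hasDerivAt_replicaAvg [Nonempty S] {H : ℝ → S → ℝ} {a : S → ℝ} {x : ℝ}
    (hH : ∀ ρ, HasDerivAt (fun x => H x ρ) (a ρ) x) {n : ℕ} (f : (Fin n → S) → ℝ) :
    HasDerivAt (fun x => replicaAvg (gibbsProb (H x)) f)
      (replicaAvg (gibbsProb (H x)) (replicaDiff a f)) x := by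
  have h : HasDerivAt (fun x => replicaAvg (gibbsProb (H x)) f)
      (∑ ρ : Fin n → S, f ρ * ∑ l, (∏ j ∈ Finset.univ.erase l, gibbsProb (H x) (ρ j)) •
        (gibbsProb (H x) (ρ l) * (a (ρ l) - ∑ ρ', gibbsProb (H x) ρ' * a ρ'))) x := by
    unfold replicaAvg
    exact HasDerivAt.fun_sum fun ρ _ =>
      (HasDerivAt.fun_finsetProd fun l _ => hasDerivAt_gibbsProb hH (ρ l)).const_mul _
  refine h.congr_deriv ?_
  set p := gibbsProb (H x) with hp
  have hp1 : ∑ x, p x = 1 := sum_gibbsProb _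
  unfold replicaAvg replicaDiff
  rw [sum_fin_succ_fun]
  simp only [Fin.tail_cons, Fin.prod_univ_succ, Fin.cons_zero, Fin.cons_succ]
  rw [Finset.sum_comm (γ := S)]
  refine Finset.sum_congr rfl fun ρ _ => ?_
  have h1 : ∀ l, (∏ j ∈ Finset.univ.erase l, p (ρ j)) •
      (p (ρ l) * (a (ρ l) - ∑ ρ', p ρ' * a ρ')) =
      (∏ j, p (ρ j)) * ∑ y, p y * (a (ρ l) - a y) := by
    intro l
    rw [← Finset.prod_erase_mul _ _ (Finset.mem_univ l)]
    simp only [mul_sub, Finset.sum_sub_distrib, ← Finset.sum_mul, hp1, smul_eq_mul]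
    ring
  simp only [h1]
  rw [← Finset.mul_sum, Finset.sum_comm, Finset.mul_sum, Finset.mul_sum]
  refine Finset.sum_congr rfl fun y _ => ?_
  rw [← Finset.mul_sum]
  ring

end Replicas

/-- The Gaussian Hamiltonian `∑ k, g k * (A ρ k + √s * B ρ k)`. -/
def interpHam {S ι : Type*} [Fintype ι] (A B : S → ι → ℝ) (s : ℝ) (g : ι → ℝ) (ρ : S) : ℝ :=
  ∑ k, g k * (A ρ k + Real.sqrt s * B ρ k)

/-- The disorder expectation of a replicated Gibbs average for `interpHam`. -/
def interpAvg {S ι : Type*} [Fintype S] [Fintype ι] (A B : S → ι → ℝ) (s : ℝ) {n : ℕ}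
    (f : (Fin n → S) → ℝ) : ℝ :=
  ∫ g, replicaAvg (gibbsProb (interpHam A B s g)) f ∂Measure.pi (fun _ : ι => gaussianReal 0 1)

/-- Half of the sum of the second-order replica derivatives in the directions `B · k`. -/
def replicaLaplace {S ι : Type*} [Fintype ι] (B : S → ι → ℝ) {n : ℕ} (f : (Fin n → S) → ℝ) :
    (Fin (n + 2) → S) → ℝ :=
  fun ρ => 1 / 2 * ∑ k, replicaDiff (fun x => B x k) (replicaDiff (fun x => B x k) f) ρ

section Interpolation

variable {S ι : Type*} [Fintype ι]

lemma replicaDiff_sum_mul (c : ι → ℝ) (B : S → ι → ℝ) {n : ℕ} (f : (Fin n → S) → ℝ) :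
    replicaDiff (fun x => ∑ k, c k * B x k) f =
      fun ρ => ∑ k, c k * replicaDiff (fun x => B x k) f ρ := by
  funext ρ
  unfold replicaDiff
  simp only [← Finset.sum_sub_distrib, ← mul_sub]
  rw [Finset.sum_comm, Finset.mul_sum]
  refine Finset.sum_congr rfl fun k _ => ?_
  rw [← Finset.mul_sum]; ring

lemma sum_replicaDiff_replicaDiff {A B : S → ι → ℝ}
    (hAB : ∀ ρ ρ', ∑ k, A ρ k * B ρ' k = 0) (c : ℝ) {n : ℕ} (f : (Fin n → S) → ℝ)
    (ρ : Fin (n + 2) → S) :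
    ∑ k, replicaDiff (fun x => A x k + c * B x k) (replicaDiff (fun x => B x k) f) ρ =
      2 * c * replicaLaplace B f ρ := by
  have h0 : ∑ k, replicaDiff (fun x => A x k) (replicaDiff (fun x => B x k) f) ρ = 0 := by
    unfold replicaDiff
    simp only [Finset.sum_mul_sum, mul_assoc]
    rw [← Finset.mul_sum, Finset.sum_comm]
    refine mul_eq_zero_of_right _ (Finset.sum_eq_zero fun l _ => ?_)
    rw [Finset.sum_comm]
    refine Finset.sum_eq_zero fun l' _ => ?_
    have : ∀ k, (B (Fin.tail ρ l.succ) k - B (Fin.tail ρ 0) k) * (A (ρ l'.succ) k - A (ρ 0) k) =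
        A (ρ l'.succ) k * B (Fin.tail ρ l.succ) k - A (ρ l'.succ) k * B (Fin.tail ρ 0) k -
          A (ρ 0) k * B (Fin.tail ρ l.succ) k + A (ρ 0) k * B (Fin.tail ρ 0) k :=
      fun k => by ring
    simp only [this, Finset.sum_add_distrib, Finset.sum_sub_distrib, hAB]
    ring
  have h1 : ∀ k, replicaDiff (fun x => A x k + c * B x k) (replicaDiff (fun x => B x k) f) ρ =
      replicaDiff (fun x => A x k) (replicaDiff (fun x => B x k) f) ρ +
        c * replicaDiff (fun x => B x k) (replicaDiff (fun x => B x k) f) ρ := by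
    intro k
    have : ∀ l : Fin (n + 1), A (ρ l.succ) k + c * B (ρ l.succ) k - (A (ρ 0) k + c * B (ρ 0) k) =
        (A (ρ l.succ) k - A (ρ 0) k) + c * (B (ρ l.succ) k - B (ρ 0) k) := fun l => by ring
    simp only [replicaDiff, this, Finset.sum_add_distrib, ← Finset.mul_sum]
    ring
  simp only [h1, Finset.sum_add_distrib, h0, ← Finset.mul_sum, replicaLaplace]
  ring

variable [Fintype S]

lemma interpAvg_const_mul (A B : S → ι → ℝ) (s : ℝ) {n : ℕ} (c : ℝ) (f : (Fin n → S) → ℝ) :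
    interpAvg A B s (fun ρ => c * f ρ) = c * interpAvg A B s f := by
  unfold interpAvg
  simp only [replicaAvg_const_mul, integral_const_mul]

variable [Nonempty S]

lemma continuous_replicaAvg_interpHam (A B : S → ι → ℝ) (s : ℝ) {n : ℕ}
    (f : (Fin n → S) → ℝ) :
    Continuous fun g => replicaAvg (gibbsProb (interpHam A B s g)) f := by
  unfold replicaAvg gibbsProb
  refine continuous_finsetSum _ fun ρ _ => continuous_const.mul
    (continuous_finsetProd _ fun l _ => Continuous.div ?_ ?_ fun g => (sum_exp_pos _).ne')
  all_goals unfold interpHam; fun_prop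

lemma integrable_replicaAvg_interpHam (A B : S → ι → ℝ) (s : ℝ) {n : ℕ}
    (f : (Fin n → S) → ℝ) :
    Integrable (fun g => replicaAvg (gibbsProb (interpHam A B s g)) f)
      (Measure.pi (fun _ : ι => gaussianReal 0 1)) :=
  Integrable.of_bound (continuous_replicaAvg_interpHam A B s f).aestronglyMeasurable
    (∑ ρ, |f ρ|) (ae_of_all _ fun _ =>
      abs_replicaAvg_le_sum (gibbsProb_nonneg _) (sum_gibbsProb _) f)

lemma interpAvg_mono (A B : S → ι → ℝ) (s : ℝ) {n : ℕ} {f h : (Fin n → S) → ℝ}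
    (hfh : ∀ ρ, f ρ ≤ h ρ) : interpAvg A B s f ≤ interpAvg A B s h :=
  integral_mono (integrable_replicaAvg_interpHam A B s f)
    (integrable_replicaAvg_interpHam A B s h)
    fun _ => replicaAvg_mono (gibbsProb_nonneg _) hfh

lemma interpAvg_sum (A B : S → ι → ℝ) (s : ℝ) {n : ℕ} {κ : Type*} (t : Finset κ)
    (f : κ → (Fin n → S) → ℝ) :
    interpAvg A B s (fun ρ => ∑ k ∈ t, f k ρ) = ∑ k ∈ t, interpAvg A B s (f k) := by
  unfold interpAvg
  simp only [replicaAvg_sum]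
  exact integral_finsetSum _ fun k _ => integrable_replicaAvg_interpHam A B s (f k)

lemma interpAvg_tail (A B : S → ι → ℝ) (s : ℝ) {n : ℕ} (f : (Fin n → S) → ℝ) :
    interpAvg A B s (fun ρ : Fin (n + 1) → S => f (Fin.tail ρ)) = interpAvg A B s f := by
  unfold interpAvg
  simp only [replicaAvg_tail (sum_gibbsProb _)]

lemma abs_interpAvg_le (A B : S → ι → ℝ) (s : ℝ) {n : ℕ} (f : (Fin n → S) → ℝ) :
    |interpAvg A B s f| ≤ interpAvg A B s (fun ρ => |f ρ|) :=
  (abs_integral_le_integral_abs).trans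
    (integral_mono (integrable_replicaAvg_interpHam A B s f).abs
      (integrable_replicaAvg_interpHam A B s _) fun _ => abs_replicaAvg_le (gibbsProb_nonneg _) f)

lemma hasDerivAt_replicaAvg_interpHam (A B : S → ι → ℝ) {s : ℝ} (hs : 0 < s) (g : ι → ℝ) {n : ℕ}
    (f : (Fin n → S) → ℝ) :
    HasDerivAt (fun s => replicaAvg (gibbsProb (interpHam A B s g)) f)
      (1 / (2 * Real.sqrt s) * ∑ k, g k *
        replicaAvg (gibbsProb (interpHam A B s g)) (replicaDiff (fun x => B x k) f)) s := by
  have hH : ∀ ρ, HasDerivAt (fun s => interpHam A B s g ρ)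
      (∑ k, (1 / (2 * Real.sqrt s) * g k) * B ρ k) s := by
    intro ρ
    unfold interpHam
    refine HasDerivAt.fun_sum fun k _ => ?_
    refine ((((Real.hasDerivAt_sqrt hs.ne').mul_const (B ρ k)).const_add (A ρ k)).const_mul
      (g k)).congr_deriv ?_
    ring
  refine (hasDerivAt_replicaAvg hH f).congr_deriv ?_
  rw [replicaDiff_sum_mul, replicaAvg_sum, Finset.mul_sum]
  refine Finset.sum_congr rfl fun k _ => ?_
  rw [replicaAvg_const_mul, mul_assoc]

lemma integral_coord_mul_replicaAvg [DecidableEq ι] (A B : S → ι → ℝ) (s : ℝ) (k : ι) {n : ℕ}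
    (f : (Fin n → S) → ℝ) :
    ∫ g, g k * replicaAvg (gibbsProb (interpHam A B s g)) f
        ∂Measure.pi (fun _ : ι => gaussianReal 0 1) =
      interpAvg A B s (replicaDiff (fun ρ => A ρ k + Real.sqrt s * B ρ k) f) := by
  refine integral_coord_mul_pi_gaussianReal k
    (continuous_replicaAvg_interpHam A B s f).measurable
    (continuous_replicaAvg_interpHam A B s _).measurable (fun x y => ?_)
    (fun g => abs_replicaAvg_le_sum (gibbsProb_nonneg _) (sum_gibbsProb _) f)
    (fun g => abs_replicaAvg_le_sum (gibbsProb_nonneg _) (sum_gibbsProb _) _)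
  refine hasDerivAt_replicaAvg (H := fun y => interpHam A B s (Function.update x k y))
    (fun ρ => ?_) f
  have h : (fun y => interpHam A B s (Function.update x k y) ρ) = fun y =>
      y * (A ρ k + Real.sqrt s * B ρ k) +
        ∑ j ∈ Finset.univ.erase k, x j * (A ρ j + Real.sqrt s * B ρ j) := by
    funext y
    unfold interpHam
    rw [← Finset.add_sum_erase _ _ (Finset.mem_univ k), Function.update_self]
    congr 1
    refine Finset.sum_congr rfl fun j hj => ?_
    rw [Function.update_of_ne (Finset.ne_of_mem_erase hj)]
  rw [h]
  simpa using ((hasDerivAt_id y).mul_const (A ρ k + Real.sqrt s * B ρ k)).add_const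
    (∑ j ∈ Finset.univ.erase k, x j * (A ρ j + Real.sqrt s * B ρ j))

/-- The derivative of the disorder expectation in the interpolation parameter. -/
lemma hasDerivAt_interpAvg {A B : S → ι → ℝ} (hAB : ∀ ρ ρ', ∑ k, A ρ k * B ρ' k = 0) {s : ℝ}
    (hs : 0 < s) {n : ℕ} (f : (Fin n → S) → ℝ) :
    HasDerivAt (fun s => interpAvg A B s f) (interpAvg A B s (replicaLaplace B f)) s := by
  classical
  have hmeas : ∀ s, Continuous fun g : ι → ℝ => 1 / (2 * Real.sqrt s) * ∑ k, g k *
      replicaAvg (gibbsProb (interpHam A B s g)) (replicaDiff (fun x => B x k) f) := fun s =>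
    continuous_const.mul (continuous_finsetSum _ fun k _ =>
      (continuous_apply k).mul (continuous_replicaAvg_interpHam A B s _))
  have hmain := (hasDerivAt_integral_of_dominated_loc_of_deriv_le
    (μ := Measure.pi (fun _ : ι => gaussianReal 0 1)) (x₀ := s)
    (F := fun s g => replicaAvg (gibbsProb (interpHam A B s g)) f)
    (F' := fun s g => 1 / (2 * Real.sqrt s) * ∑ k, g k *
        replicaAvg (gibbsProb (interpHam A B s g)) (replicaDiff (fun x => B x k) f))
    (bound := fun g => 1 / (2 * Real.sqrt (s / 2)) * ∑ k, |g k| *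
      ∑ ρ, |replicaDiff (fun x => B x k) f ρ|)
    (Ioi_mem_nhds (half_lt_self hs))
    (Eventually.of_forall fun s =>
      (continuous_replicaAvg_interpHam A B s f).aestronglyMeasurable)
    (integrable_replicaAvg_interpHam A B s f) (hmeas s).aestronglyMeasurable
    (ae_of_all _ fun g x hx => ?_) ?_ (ae_of_all _ fun g x hx => ?_)).2
  · refine hmain.congr_deriv ?_
    rw [integral_const_mul, integral_finsetSum]
    · simp only [integral_coord_mul_replicaAvg]
      rw [← interpAvg_sum]
      simp only [sum_replicaDiff_replicaDiff hAB, interpAvg_const_mul]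
      have := (Real.sqrt_pos.2 hs).ne'
      field_simp
    · intro k _
      exact (integrable_coord k).mul_bdd (c := ∑ ρ, |replicaDiff (fun x => B x k) f ρ|)
        (continuous_replicaAvg_interpHam A B s _).aestronglyMeasurable
        (ae_of_all _ fun g => abs_replicaAvg_le_sum (gibbsProb_nonneg _) (sum_gibbsProb _) _)
  · have hx' : s / 2 < x := hx
    have h1 : 0 < Real.sqrt (s / 2) := Real.sqrt_pos.2 (half_pos hs)
    have h2 : Real.sqrt (s / 2) ≤ Real.sqrt x := Real.sqrt_le_sqrt hx'.le
    rw [Real.norm_eq_abs, abs_mul, abs_of_nonneg (by positivity)]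
    refine mul_le_mul (by gcongr) ?_ (abs_nonneg _) (by positivity)
    refine (Finset.abs_sum_le_sum_abs _ _).trans (Finset.sum_le_sum fun k _ => ?_)
    rw [abs_mul]
    exact mul_le_mul_of_nonneg_left
      (abs_replicaAvg_le_sum (gibbsProb_nonneg _) (sum_gibbsProb _) _) (abs_nonneg _)
  · exact (integrable_finsetSum _ fun k _ => (integrable_coord k).abs.mul_const _).const_mul _
  · exact hasDerivAt_replicaAvg_interpHam A B ((half_pos hs).trans hx) g f

end Interpolation

section Bounds

variable {S ι : Type*} [Fintype ι]

lemma replicaLaplace_eq (B : S → ι → ℝ) (c₀ : ℝ) {n : ℕ} (f : (Fin n → S) → ℝ)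
    (C : Fin (n + 2) → Fin (n + 2) → ℝ) (ρ : Fin (n + 2) → S)
    (hC : ∀ i j, C i j = ∑ k, B (ρ i) k * B (ρ j) k - if i = j then c₀ else 0) :
    replicaLaplace B f ρ = 1 / 2 * (f (Fin.tail (Fin.tail ρ)) *
      ∑ l : Fin n, ∑ l' : Fin (n + 1), (C l.succ.succ l'.succ - C l.succ.succ 0 -
        C 1 l'.succ + C 1 0)) := by
  unfold replicaLaplace replicaDiff
  congr 1
  simp only [mul_assoc]
  rw [← Finset.mul_sum]
  congr 1
  simp only [Finset.sum_mul_sum]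
  rw [Finset.sum_comm]
  refine Finset.sum_congr rfl fun l _ => ?_
  have hδ : ∑ l' : Fin (n + 1), ((if l.succ.succ = l'.succ then c₀ else 0) -
      (if (1 : Fin (n + 2)) = l'.succ then c₀ else 0)) = 0 := by
    rw [Finset.sum_sub_distrib, ← Fin.succ_zero_eq_one]
    simp only [Fin.succ_inj, Finset.sum_ite_eq, Finset.mem_univ, if_true, sub_self]
  rw [Finset.sum_comm, ← sub_zero (∑ l' : Fin (n + 1), ∑ k, _), ← hδ, ← Finset.sum_sub_distrib]
  refine Finset.sum_congr rfl fun l' _ => ?_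
  have h1 : ∑ k, (B (Fin.tail ρ l.succ) k - B (Fin.tail ρ 0) k) *
      (B (ρ l'.succ) k - B (ρ 0) k) = ∑ k, B (ρ l.succ.succ) k * B (ρ l'.succ) k -
        ∑ k, B (ρ l.succ.succ) k * B (ρ 0) k - ∑ k, B (ρ 1) k * B (ρ l'.succ) k +
          ∑ k, B (ρ 1) k * B (ρ 0) k := by
    simp only [← Finset.sum_sub_distrib, ← Finset.sum_add_distrib]
    refine Finset.sum_congr rfl fun k _ => ?_
    simp only [Fin.tail, Fin.succ_zero_eq_one]
    ring
  rw [h1, hC, hC, hC, hC, if_neg (Fin.succ_ne_zero _), if_neg (one_ne_zero (α := Fin (n + 2)))]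
  ring

lemma abs_replicaLaplace_le (B : S → ι → ℝ) (c₀ M : ℝ) {n : ℕ} (f : (Fin n → S) → ℝ)
    (ρ : Fin (n + 2) → S)
    (hM : ∀ i j, |∑ k, B (ρ i) k * B (ρ j) k - if i = j then c₀ else 0| ≤ M) :
    |replicaLaplace B f ρ| ≤ 2 * n * (n + 1) * M * |f (Fin.tail (Fin.tail ρ))| := by
  rw [replicaLaplace_eq B c₀ f _ ρ fun i j => rfl, abs_mul, abs_mul]
  have h : |∑ l : Fin n, ∑ l' : Fin (n + 1),
      ((∑ k, B (ρ l.succ.succ) k * B (ρ l'.succ) k -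
          if l.succ.succ = l'.succ then c₀ else 0) -
        (∑ k, B (ρ l.succ.succ) k * B (ρ 0) k - if l.succ.succ = 0 then c₀ else 0) -
        (∑ k, B (ρ 1) k * B (ρ l'.succ) k - if 1 = l'.succ then c₀ else 0) +
        (∑ k, B (ρ 1) k * B (ρ 0) k - if (1 : Fin (n + 2)) = 0 then c₀ else 0))| ≤
      ∑ l : Fin n, ∑ l' : Fin (n + 1), 4 * M := by
    refine (Finset.abs_sum_le_sum_abs _ _).trans (Finset.sum_le_sum fun l _ => ?_)
    refine (Finset.abs_sum_le_sum_abs _ _).trans (Finset.sum_le_sum fun l' _ => ?_)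
    have h1 := abs_le.1 (hM l.succ.succ l'.succ)
    have h2 := abs_le.1 (hM l.succ.succ 0)
    have h3 := abs_le.1 (hM 1 l'.succ)
    have h4 := abs_le.1 (hM 1 0)
    exact abs_le.2 ⟨by linarith, by linarith⟩
  simp only [Finset.sum_const, Finset.card_univ, Fintype.card_fin, nsmul_eq_mul] at h
  rw [abs_of_pos (by norm_num : (0 : ℝ) < 1 / 2)]
  have h5 := mul_le_mul_of_nonneg_left h (abs_nonneg (f (Fin.tail (Fin.tail ρ))))
  push_cast at h5
  linarith

lemma abs_replicaLaplace_iterate_le (B : S → ι → ℝ) (c₀ : ℝ) {M : ℝ} (hM0 : 0 ≤ M)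
    (f : (Fin 1 → S) → ℝ) (ρ : Fin 7 → S)
    (hM : ∀ i j, |∑ k, B (ρ i) k * B (ρ j) k - if i = j then c₀ else 0| ≤ M)
    (hf : |f (fun _ => ρ 6)| ≤ M) :
    |replicaLaplace B (replicaLaplace B (replicaLaplace B f)) ρ| ≤ 5760 * M ^ 4 := by
  have h3 := abs_replicaLaplace_le B c₀ M (replicaLaplace B (replicaLaplace B f)) ρ hM
  have h2 := abs_replicaLaplace_le B c₀ M (replicaLaplace B f) (Fin.tail (Fin.tail ρ))
    fun i j => by simpa [Fin.tail] using hM i.succ.succ j.succ.succ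
  have h1 := abs_replicaLaplace_le B c₀ M f (Fin.tail (Fin.tail (Fin.tail (Fin.tail ρ))))
    fun i j => by simpa [Fin.tail] using hM i.succ.succ.succ.succ j.succ.succ.succ.succ
  have h0 : Fin.tail (Fin.tail (Fin.tail (Fin.tail (Fin.tail (Fin.tail ρ))))) =
      fun _ : Fin 1 => ρ 6 := by
    funext i
    fin_cases i
    rfl
  rw [h0] at h1
  push_cast at h1 h2 h3
  calc |replicaLaplace B (replicaLaplace B (replicaLaplace B f)) ρ|
      ≤ 2 * 5 * (5 + 1) * M * (2 * 3 * (3 + 1) * M * (2 * 1 * (1 + 1) * M * M)) := by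
        refine h3.trans (mul_le_mul_of_nonneg_left ?_ (by positivity))
        refine h2.trans (mul_le_mul_of_nonneg_left ?_ (by positivity))
        exact h1.trans (mul_le_mul_of_nonneg_left hf (by positivity))
    _ = 5760 * M ^ 4 := by ring

variable [Fintype S] [Nonempty S]

/-- Averages of a nonnegative function at two parameters in `(0, 1]` are comparable. -/
lemma interpAvg_le_exp_mul {A B : S → ι → ℝ} (hAB : ∀ ρ ρ', ∑ k, A ρ k * B ρ' k = 0) {M : ℝ}
    (hM : ∀ x y, |∑ k, B x k * B y k| ≤ M) {n : ℕ} {f : (Fin n → S) → ℝ} (hf : ∀ ρ, 0 ≤ f ρ)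
    {s : ℝ} (hs : 0 < s) (hs1 : s ≤ 1) :
    interpAvg A B s f ≤ Real.exp (2 * n * (n + 1) * M) * interpAvg A B 1 f := by
  set c : ℝ := 2 * n * (n + 1) * M with hc
  have hM0 : 0 ≤ M := (abs_nonneg _).trans (hM (Classical.arbitrary S) (Classical.arbitrary S))
  have hc0 : 0 ≤ c := by positivity
  have hd : ∀ s, 0 < s → HasDerivAt (fun s => Real.exp (c * s) * interpAvg A B s f)
      (Real.exp (c * s) * (c * interpAvg A B s f + interpAvg A B s (replicaLaplace B f))) s := by
    intro s hs
    refine (((hasDerivAt_id s).const_mul c).exp.mul (hasDerivAt_interpAvg hAB hs f)).congr_deriv ?_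
    simp only [id]; ring
  have hlow : ∀ s, -(c * interpAvg A B s f) ≤ interpAvg A B s (replicaLaplace B f) := by
    intro s
    refine (abs_le.1 ((abs_interpAvg_le A B s _).trans ?_)).1
    rw [← interpAvg_tail A B s f, ← interpAvg_tail A B s (fun ρ => f (Fin.tail ρ)),
      ← interpAvg_const_mul]
    refine interpAvg_mono A B s fun ρ => ?_
    have := abs_replicaLaplace_le B 0 M f ρ fun i j => by simpa using hM (ρ i) (ρ j)
    rwa [abs_of_nonneg (hf _)] at this
  have hmono : MonotoneOn (fun s => Real.exp (c * s) * interpAvg A B s f) (Set.Ioi 0) := by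
    refine monotoneOn_of_deriv_nonneg (convex_Ioi 0)
      (fun x hx => (hd x hx).continuousAt.continuousWithinAt) ?_ ?_
    · rw [interior_Ioi]
      exact fun x hx => (hd x hx).differentiableAt.differentiableWithinAt
    · rw [interior_Ioi]
      intro x hx
      rw [(hd x hx).deriv]
      exact mul_nonneg (Real.exp_pos _).le (by linarith [hlow x])
  have h := hmono (Set.mem_Ioi.2 hs) (Set.mem_Ioi.2 one_pos) hs1
  simp only [mul_one] at h
  refine le_trans ?_ h
  have hnn : 0 ≤ interpAvg A B s f :=
    integral_nonneg fun g => Finset.sum_nonneg fun ρ _ => mul_nonneg (hf _)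
      (Finset.prod_nonneg fun _ _ => gibbsProb_nonneg _ _)
  exact le_mul_of_one_le_left hnn (Real.one_le_exp (by positivity))

end Bounds

lemma deriv_eq_zero_of_Iic_eq_zero {φ : ℝ → ℝ} {c : ℝ} (h : ∀ s ≤ 0, φ s = c) :
    ∀ s ≤ 0, deriv φ s = 0 := by
  intro s hs
  by_cases hd : DifferentiableAt ℝ φ s
  · have h1 : HasDerivWithinAt φ (deriv φ s) (Set.Iic s) s := hd.hasDerivAt.hasDerivWithinAt
    have h2 : HasDerivWithinAt φ 0 (Set.Iic s) s :=
      (hasDerivWithinAt_const s _ c).congr (fun x hx => h x (le_trans hx hs)) (h s hs)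
    exact (uniqueDiffWithinAt_Iic s).eq_deriv _ h1 h2
  · exact deriv_zero_of_not_differentiableAt hd

lemma iteratedDeriv_three_eq_of_hasDerivAt {φ₀ φ₁ φ₂ φ₃ : ℝ → ℝ}
    (h₀ : ∀ s, 0 < s → HasDerivAt φ₀ (φ₁ s) s) (h₁ : ∀ s, 0 < s → HasDerivAt φ₁ (φ₂ s) s)
    (h₂ : ∀ s, 0 < s → HasDerivAt φ₂ (φ₃ s) s) {s : ℝ} (hs : 0 < s) :
    iteratedDeriv 3 φ₀ s = φ₃ s := by
  have deriv_congr : ∀ {φ ψ χ : ℝ → ℝ}, (∀ s, 0 < s → φ s = ψ s) →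
      (∀ s, 0 < s → HasDerivAt ψ (χ s) s) → ∀ s, 0 < s → deriv φ s = χ s := by
    intro φ ψ χ h hd s hs
    refine Eq.trans (EventuallyEq.deriv_eq ?_) (hd s hs).deriv
    filter_upwards [Ioi_mem_nhds hs] with x hx using h x hx
  rw [iteratedDeriv_succ, iteratedDeriv_succ, iteratedDeriv_one]
  exact deriv_congr (deriv_congr (fun s hs => (h₀ s hs).deriv) h₁) h₂ s hs

lemma iteratedDeriv_three_eq_zero_of_Iic {φ : ℝ → ℝ} {c : ℝ} (h : ∀ s ≤ 0, φ s = c) :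
    iteratedDeriv 3 φ 0 = 0 := by
  rw [iteratedDeriv_succ, iteratedDeriv_succ, iteratedDeriv_one]
  exact deriv_eq_zero_of_Iic_eq_zero (deriv_eq_zero_of_Iic_eq_zero
    (deriv_eq_zero_of_Iic_eq_zero h)) 0 le_rfl

/-- The first (`true`) or second (`false`) component of a pair. -/
def pairComp {T : Type*} (a : Bool) (x : T × T) : T := if a then x.1 else x.2

section Pairs

variable {T : Type*} [Fintype T]

lemma replicaAvg_one {S : Type*} [Fintype S] (p : S → ℝ) (f : (Fin 1 → S) → ℝ) :
    replicaAvg p f = ∑ x, f (fun _ => x) * p x := by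
  unfold replicaAvg
  rw [← (Equiv.funUnique (Fin 1) S).symm.sum_comp]
  refine Finset.sum_congr rfl fun x _ => ?_
  simp only [Fin.prod_univ_one]
  rfl

lemma replicaAvg_two {S : Type*} [Fintype S] (p : S → ℝ) (f : S → S → ℝ) :
    replicaAvg p (fun ρ : Fin 2 → S => f (ρ 0) (ρ 1)) = ∑ x, ∑ y, f x y * (p x * p y) := by
  unfold replicaAvg
  rw [← (finTwoArrowEquiv S).symm.sum_comp, Fintype.sum_prod_type]
  refine Finset.sum_congr rfl fun x _ => Finset.sum_congr rfl fun y _ => ?_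
  simp [Fin.prod_univ_two, finTwoArrowEquiv]

lemma gibbsProb_add (H₁ H₂ : T → ℝ) (x : T × T) :
    gibbsProb (fun x : T × T => H₁ x.1 + H₂ x.2) x = gibbsProb H₁ x.1 * gibbsProb H₂ x.2 := by
  unfold gibbsProb
  simp only [Real.exp_add]
  rw [Fintype.sum_prod_type, div_mul_div_comm, Finset.sum_mul_sum]

lemma replicaAvg_mul_of_ne {S : Type*} [Fintype S] {p : S → ℝ} (hp : ∑ x, p x = 1) {n : ℕ}
    {i j : Fin n} (hij : i ≠ j) (u v : S → ℝ) :
    replicaAvg p (fun ρ => u (ρ i) * v (ρ j)) = (∑ x, u x * p x) * ∑ x, v x * p x := by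
  have h := replicaAvg_prod (p := p)
    (fun l x => (if l = i then u x else 1) * (if l = j then v x else 1))
  have h1 : ∀ ρ : Fin n → S, ∏ l, ((if l = i then u (ρ l) else 1) *
      (if l = j then v (ρ l) else 1)) = u (ρ i) * v (ρ j) := by
    intro ρ
    rw [Finset.prod_mul_distrib]
    simp
  have h2 : ∀ l, ∑ x, (if l = i then u x else 1) * (if l = j then v x else 1) * p x =
      (if l = i then ∑ x, u x * p x else 1) * (if l = j then ∑ x, v x * p x else 1) := by
    intro l
    by_cases hi : l = i
    · simp [hi, hij]
    · by_cases hj : l = j <;> simp [hi, hj, hp, hij.symm]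
  simp only [h1, h2] at h
  rw [h, Finset.prod_mul_distrib]
  simp

lemma replicaAvg_eval {S : Type*} [Fintype S] {p : S → ℝ} (hp : ∑ x, p x = 1) {n : ℕ}
    (i : Fin n) (u : S → ℝ) :
    replicaAvg p (fun ρ => u (ρ i)) = ∑ x, u x * p x := by
  have h := replicaAvg_prod (p := p) (fun l x => if l = i then u x else 1)
  have h2 : ∀ l, ∑ x, (if l = i then u x else 1) * p x =
      if l = i then ∑ x, u x * p x else 1 := by
    intro l
    by_cases hi : l = i <;> simp [hi, hp]
  simp only [h2] at h
  simpa using h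

lemma replicaAvg_pairComp_mul {p₁ p₂ : T → ℝ} (h₁ : ∑ x, p₁ x = 1) (h₂ : ∑ x, p₂ x = 1)
    {n : ℕ} {i j : Fin n} {a b : Bool} (hne : (i, a) ≠ (j, b)) (u : T → ℝ) :
    replicaAvg (fun x : T × T => p₁ x.1 * p₂ x.2)
        (fun ρ => u (pairComp a (ρ i)) * u (pairComp b (ρ j))) =
      (∑ x : T × T, u (pairComp a x) * (p₁ x.1 * p₂ x.2)) *
        ∑ x : T × T, u (pairComp b x) * (p₁ x.1 * p₂ x.2) := by
  have hp : ∑ x : T × T, p₁ x.1 * p₂ x.2 = 1 := by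
    rw [Fintype.sum_prod_type, ← Finset.sum_mul_sum, h₁, h₂, one_mul]
  by_cases hij : i = j
  · subst hij
    have hab : a ≠ b := fun h => hne (by rw [h])
    rw [replicaAvg_eval hp i fun x => u (pairComp a x) * u (pairComp b x)]
    have e1 : ∑ x : T × T, u x.1 * (p₁ x.1 * p₂ x.2) = ∑ x, u x * p₁ x := by
      rw [Fintype.sum_prod_type]
      refine Finset.sum_congr rfl fun x _ => ?_
      simp only
      rw [← Finset.mul_sum, ← Finset.mul_sum, h₂, mul_one]
    have e2 : ∑ x : T × T, u x.2 * (p₁ x.1 * p₂ x.2) = ∑ x, u x * p₂ x := by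
      rw [Fintype.sum_prod_type_right]
      refine Finset.sum_congr rfl fun x _ => ?_
      simp only
      rw [← Finset.mul_sum, ← Finset.sum_mul, h₁, one_mul]
    have e3 : ∑ x : T × T, u x.1 * u x.2 * (p₁ x.1 * p₂ x.2) =
        (∑ x, u x * p₁ x) * ∑ x, u x * p₂ x := by
      rw [Fintype.sum_prod_type, Finset.sum_mul_sum]
      exact Finset.sum_congr rfl fun x _ => Finset.sum_congr rfl fun y _ => by ring
    cases a <;> cases b <;> simp_all [pairComp, mul_comm (u _) (u _)]
    exact mul_comm _ _
  · exact replicaAvg_mul_of_ne hp hij (fun x => u (pairComp a x)) (fun x => u (pairComp b x))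

/-- The average of a positive-definite kernel between any two distinct components of the
replicated pairs is at most the sum of its averages between two replicas of the same component. -/
lemma replicaAvg_kernel_le {p₁ p₂ : T → ℝ} (h₁ : ∑ x, p₁ x = 1) (h₂ : ∑ x, p₂ x = 1)
    {κ : Type*} (s : Finset κ) (u : κ → T → ℝ) {r : T → T → ℝ}
    (hr : ∀ x y, r x y = ∑ A ∈ s, u A x * u A y)
    {n : ℕ} {i j : Fin n} {a b : Bool} (hne : (i, a) ≠ (j, b)) :
    replicaAvg (fun x : T × T => p₁ x.1 * p₂ x.2)
        (fun ρ => r (pairComp a (ρ i)) (pairComp b (ρ j))) ≤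
      replicaAvg (fun x : T × T => p₁ x.1 * p₂ x.2)
        (fun ρ : Fin 2 → T × T => ∑ c : Bool, r (pairComp c (ρ 0)) (pairComp c (ρ 1))) := by
  simp only [hr]
  rw [replicaAvg_sum, replicaAvg_sum]
  simp only [replicaAvg_sum]
  rw [Finset.sum_comm]
  refine Finset.sum_le_sum fun A _ => ?_
  have hc : ∀ c : Bool, ((0 : Fin 2), c) ≠ (1, c) := fun c h => by simp at h
  simp only [replicaAvg_pairComp_mul h₁ h₂ hne, replicaAvg_pairComp_mul h₁ h₂ (hc _),
    Fintype.sum_bool]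
  set m : Bool → ℝ := fun c => ∑ x : T × T, u A (pairComp c x) * (p₁ x.1 * p₂ x.2)
  change m a * m b ≤ m true * m true + m false * m false
  cases a <;> cases b <;>
    nlinarith [sq_nonneg (m true - m false), sq_nonneg (m true), sq_nonneg (m false)]

end Pairs

/-- A normalized combination of two independent standard Gaussian vectors is a standard
Gaussian vector. -/
lemma measurePreserving_gaussian_combination {ι : Type*} [Fintype ι] {a b : ℝ}
    (hab : a ^ 2 + b ^ 2 = 1) :
    MeasurePreserving (fun (z : (ι → ℝ) × (ι → ℝ)) i => a * z.1 i + b * z.2 i)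
      ((Measure.pi fun _ : ι => gaussianReal 0 1).prod (Measure.pi fun _ : ι => gaussianReal 0 1))
      (Measure.pi fun _ : ι => gaussianReal 0 1) := by
  have h1 : ((gaussianReal 0 1).prod (gaussianReal 0 1)).map
      (fun z : ℝ × ℝ => a * z.1 + b * z.2) = gaussianReal 0 1 := by
    have h : (gaussianReal 0 1).map (a * ·) ∗ (gaussianReal 0 1).map (b * ·) =
        gaussianReal 0 1 := by
      rw [gaussianReal_map_const_mul, gaussianReal_map_const_mul, gaussianReal_conv_gaussianReal]
      congr 1
      · simp
      · ext; simpa using hab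
    rw [Measure.conv, Measure.map_prod_map _ _ (by fun_prop) (by fun_prop),
      Measure.map_map (by fun_prop) (by fun_prop)] at h
    exact h
  have h2 : MeasurePreserving (fun (z : ι → ℝ × ℝ) i => a * (z i).1 + b * (z i).2)
      (Measure.pi fun _ : ι => (gaussianReal 0 1).prod (gaussianReal 0 1))
      (Measure.pi fun _ : ι => gaussianReal 0 1) :=
    measurePreserving_pi _ _ fun _ => ⟨by fun_prop, h1⟩
  have h3 := (measurePreserving_arrowProdEquivProdArrow ℝ ℝ ι
    (fun _ => gaussianReal 0 1) (fun _ => gaussianReal 0 1)).symm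
  exact h2.comp h3

/-- The coefficient of `g p` in the cavity Hamiltonian. -/
def cavCoef (N : ℕ) (β : ℝ) (σ : Config N) (p : Fin N × Fin N) : ℝ :=
  if p.1 < p.2 ∧ (p.2 : ℕ) < N - 1 then β / Real.sqrt N * spin (σ p.1) * spin (σ p.2) else 0

/-- The coefficient of `g p` in the cavity field. -/
def fieldCoef (N : ℕ) (β : ℝ) (σ : Config N) (p : Fin N × Fin N) : ℝ :=
  if (p.1 : ℕ) < N - 1 ∧ (p.2 : ℕ) = N - 1 then
    β / Real.sqrt N * spin (σ p.1) * spin (σ p.2) else 0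

/-- The coefficients of the coupled Hamiltonian in the three disorders `g, g', g''`, for a
single-system Hamiltonian with coefficients `c`. -/
def pairCoef {T κ : Type*} (c : T → κ → ℝ) (t : ℝ) (ρ : T × T) : κ ⊕ κ ⊕ κ → ℝ
  | .inl p => Real.sqrt t * (c ρ.1 p + c ρ.2 p)
  | .inr (.inl p) => Real.sqrt (1 - t) * c ρ.1 p
  | .inr (.inr p) => Real.sqrt (1 - t) * c ρ.2 p

lemma sum_pairCoef_mul_pairCoef {T κ : Type*} [Fintype κ] (c d : T → κ → ℝ) {t : ℝ}
    (ht : t ∈ Set.Icc (0 : ℝ) 1) (ρ ρ' : T × T) :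
    ∑ k, pairCoef c t ρ k * pairCoef d t ρ' k =
      ∑ p, c ρ.1 p * d ρ'.1 p + ∑ p, c ρ.2 p * d ρ'.2 p +
        t * (∑ p, c ρ.1 p * d ρ'.2 p + ∑ p, c ρ.2 p * d ρ'.1 p) := by
  simp only [Fintype.sum_sum_type, pairCoef, mul_add, Finset.mul_sum, ← Finset.sum_add_distrib]
  refine Finset.sum_congr rfl fun p _ => ?_
  have h1 := Real.mul_self_sqrt ht.1
  have h2 := Real.mul_self_sqrt (sub_nonneg.2 ht.2)
  linear_combination (c ρ.1 p + c ρ.2 p) * (d ρ'.1 p + d ρ'.2 p) * h1 +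
    (c ρ.1 p * d ρ'.1 p + c ρ.2 p * d ρ'.2 p) * h2

lemma hamCav_eq_sum (N : ℕ) (β : ℝ) (g : Fin N × Fin N → ℝ) (σ : Config N) :
    hamCav N β g σ = ∑ p, g p * cavCoef N β σ p := by
  unfold hamCav cavCoef
  rw [Finset.sum_filter, Finset.mul_sum]
  refine Finset.sum_congr rfl fun p _ => ?_
  split_ifs <;> ring

lemma sum_last_column {N : ℕ} (hN : 0 < N) (F : Fin N × Fin N → ℝ) :
    ∑ p : Fin N × Fin N, (if (p.1 : ℕ) < N - 1 ∧ (p.2 : ℕ) = N - 1 then F p else 0) =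
      ∑ i ∈ Finset.univ.filter (fun i : Fin N => (i : ℕ) < N - 1),
        F (i, ⟨N - 1, Nat.sub_lt hN Nat.one_pos⟩) := by
  rw [Fintype.sum_prod_type, Finset.sum_filter]
  refine Finset.sum_congr rfl fun i _ => ?_
  rw [Finset.sum_eq_single ⟨N - 1, Nat.sub_lt hN Nat.one_pos⟩]
  · simp
  · intro j _ hj
    rw [if_neg]
    rintro ⟨_, h⟩
    exact hj (Fin.ext h)
  · simp

lemma cavField_eq_sum {N : ℕ} (hN : 0 < N) (β t : ℝ) (g g' : Fin N × Fin N → ℝ) (σ : Config N) :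
    cavField N β t g g' σ =
      ∑ p, (Real.sqrt t * g p + Real.sqrt (1 - t) * g' p) * fieldCoef N β σ p := by
  unfold cavField fieldCoef
  simp only [mul_ite, mul_zero]
  rw [dif_pos hN, sum_last_column hN, Finset.mul_sum]
  exact Finset.sum_congr rfl fun i _ => by ring

lemma ham_eq_sum {N : ℕ} (β : ℝ) (g : Fin N × Fin N → ℝ) (σ : Config N) :
    ham N β g σ = ∑ p, g p * (cavCoef N β σ p + fieldCoef N β σ p) := by
  unfold ham cavCoef fieldCoef
  rw [Finset.sum_filter, Finset.mul_sum]
  refine Finset.sum_congr rfl fun p _ => ?_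
  have h1 := p.1.2
  have h2 := p.2.2
  by_cases hlt : p.1 < p.2
  · have hlt' : (p.1 : ℕ) < p.2 := hlt
    by_cases hl : (p.2 : ℕ) < N - 1
    · rw [if_pos hlt, if_pos ⟨hlt, hl⟩, if_neg (by omega)]; ring
    · rw [if_pos hlt, if_neg (by tauto), if_pos (by omega)]; ring
  · have hlt' : ¬ (p.1 : ℕ) < p.2 := hlt
    rw [if_neg hlt, if_neg (by tauto), if_neg (by omega)]; ring

lemma sum_cavCoef_mul_fieldCoef (N : ℕ) (β : ℝ) (σ τ : Config N) :
    ∑ p, cavCoef N β σ p * fieldCoef N β τ p = 0 := by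
  refine Finset.sum_eq_zero fun p _ => ?_
  unfold cavCoef fieldCoef
  by_cases h : p.1 < p.2 ∧ (p.2 : ℕ) < N - 1
  · rw [if_pos h, if_neg (by omega), mul_zero]
  · rw [if_neg h, zero_mul]

lemma sum_fieldCoef_mul_fieldCoef {N : ℕ} (hN : 0 < N) (β : ℝ) (σ τ : Config N) :
    ∑ p, fieldCoef N β σ p * fieldCoef N β τ p =
      β ^ 2 * (spinLast σ * spinLast τ * ovlpm N σ τ) := by
  have h : ∀ p, fieldCoef N β σ p * fieldCoef N β τ p =
      if (p.1 : ℕ) < N - 1 ∧ (p.2 : ℕ) = N - 1 then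
        (β / Real.sqrt N * spin (σ p.1) * spin (σ p.2)) *
          (β / Real.sqrt N * spin (τ p.1) * spin (τ p.2)) else 0 := by
    intro p
    unfold fieldCoef
    split_ifs <;> simp
  simp only [h]
  rw [sum_last_column hN]
  unfold spinLast ovlpm
  rw [dif_pos hN, dif_pos hN, Finset.sum_div, Finset.mul_sum, Finset.mul_sum]
  refine Finset.sum_congr rfl fun i _ => ?_
  have hs : Real.sqrt N * Real.sqrt N = N := Real.mul_self_sqrt (Nat.cast_nonneg N)
  have hβ : β / Real.sqrt N * (β / Real.sqrt N) = β ^ 2 / N := by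
    rw [div_mul_div_comm, hs, sq]
  linear_combination spin (σ i) * spin (σ ⟨N - 1, Nat.sub_lt hN Nat.one_pos⟩) * spin (τ i) *
    spin (τ ⟨N - 1, Nat.sub_lt hN Nat.one_pos⟩) * hβ

lemma spin_mul_self (b : Bool) : spin b * spin b = 1 := by cases b <;> simp [spin]

lemma abs_spin (b : Bool) : |spin b| = 1 := by cases b <;> simp [spin]

lemma abs_spinLast_le {N : ℕ} (σ : Config N) : |spinLast σ| ≤ 1 := by
  unfold spinLast
  split_ifs
  · rw [abs_spin]
  · simp

lemma spinLast_mul_self {N : ℕ} (hN : 0 < N) (σ : Config N) : spinLast σ * spinLast σ = 1 := by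
  unfold spinLast
  rw [dif_pos hN, spin_mul_self]

lemma ovlpm_self {N : ℕ} (σ : Config N) :
    ovlpm N σ σ = #(Finset.univ.filter fun i : Fin N => (i : ℕ) < N - 1) / (N : ℝ) := by
  simp [ovlpm, spin_mul_self]

lemma abs_ovlpm_le {N : ℕ} (hN : 0 < N) (σ τ : Config N) : |ovlpm N σ τ| ≤ 1 := by
  have hN' : (0 : ℝ) < N := Nat.cast_pos.2 hN
  unfold ovlpm
  rw [abs_div, abs_of_pos hN', div_le_one hN']
  refine (Finset.abs_sum_le_sum_abs _ _).trans ?_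
  simp only [abs_mul, abs_spin, mul_one, Finset.sum_const, nsmul_eq_mul]
  exact_mod_cast (Finset.card_le_univ _).trans (Fintype.card_fin N).le

lemma abs_spinLast_mul_ovlpm_le {N : ℕ} (σ τ : Config N) :
    |spinLast σ * spinLast τ * ovlpm N σ τ| ≤ |ovlpm N σ τ| := by
  rw [abs_mul, abs_mul]
  have := mul_le_one₀ (abs_spinLast_le σ) (abs_nonneg _) (abs_spinLast_le τ)
  exact mul_le_of_le_one_left (abs_nonneg _) this

lemma interpHam_pairCoef {N : ℕ} (hN : 0 < N) (β t s : ℝ)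
    (G : (Fin N × Fin N) ⊕ (Fin N × Fin N) ⊕ (Fin N × Fin N) → ℝ) (ρ : Config N × Config N) :
    interpHam (pairCoef (cavCoef N β) t) (pairCoef (fieldCoef N β) t) s G ρ =
      hamTS N β t s (fun p => G (.inl p)) (fun p => G (.inr (.inl p))) ρ.1 +
        hamTS N β t s (fun p => G (.inl p)) (fun p => G (.inr (.inr p))) ρ.2 := by
  unfold interpHam hamTS
  simp only [hamCav_eq_sum, cavField_eq_sum hN, Fintype.sum_sum_type, pairCoef, Finset.mul_sum,
    ← Finset.sum_add_distrib]
  exact Finset.sum_congr rfl fun p _ => by ring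

lemma hamTS_one {N : ℕ} (hN : 0 < N) (β t : ℝ) (g g' : Fin N × Fin N → ℝ) (σ : Config N) :
    hamTS N β t 1 g g' σ =
      ham N β (fun p => Real.sqrt t * g p + Real.sqrt (1 - t) * g' p) σ := by
  unfold hamTS
  simp only [ham_eq_sum, hamCav_eq_sum, cavField_eq_sum hN, Real.sqrt_one, one_mul,
    Finset.mul_sum, ← Finset.sum_add_distrib]
  exact Finset.sum_congr rfl fun p _ => by ring

lemma gibbsProb_interpHam_pairCoef {N : ℕ} (hN : 0 < N) (β t s : ℝ)
    (G : (Fin N × Fin N) ⊕ (Fin N × Fin N) ⊕ (Fin N × Fin N) → ℝ) :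
    gibbsProb (interpHam (pairCoef (cavCoef N β) t) (pairCoef (fieldCoef N β) t) s G) =
      fun ρ => gibbsProb (hamTS N β t s (fun p => G (.inl p)) (fun p => G (.inr (.inl p)))) ρ.1 *
        gibbsProb (hamTS N β t s (fun p => G (.inl p)) (fun p => G (.inr (.inr p)))) ρ.2 := by
  funext ρ
  rw [← gibbsProb_add]
  congr 1
  funext ρ'
  exact interpHam_pairCoef hN β t s G ρ'

lemma measurePreserving_disM3 (N : ℕ) :
    MeasurePreserving (fun G : (Fin N × Fin N) ⊕ (Fin N × Fin N) ⊕ (Fin N × Fin N) → ℝ =>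
      ((fun p => G (.inl p)), (fun p => G (.inr (.inl p))), (fun p => G (.inr (.inr p)))))
      (Measure.pi fun _ => gaussianReal 0 1) (disM3 N) := by
  have h1 := measurePreserving_sumPiEquivProdPi
    (fun _ : (Fin N × Fin N) ⊕ (Fin N × Fin N) ⊕ (Fin N × Fin N) => gaussianReal 0 1)
  have h2 := measurePreserving_sumPiEquivProdPi
    (fun _ : (Fin N × Fin N) ⊕ (Fin N × Fin N) => gaussianReal 0 1)
  exact ((MeasurePreserving.id (gaussPi N)).prod h2).comp h1

lemma EgibbsTS1_eq_interpAvg {N : ℕ} (hN : 0 < N) (β t s : ℝ)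
    (f : Config N × Config N → ℝ) :
    EgibbsTS1 N β t s f =
      interpAvg (pairCoef (cavCoef N β) t) (pairCoef (fieldCoef N β) t) s
        (fun ρ : Fin 1 → Config N × Config N => f (ρ 0)) := by
  have hpt : ∀ G : (Fin N × Fin N) ⊕ (Fin N × Fin N) ⊕ (Fin N × Fin N) → ℝ,
      replicaAvg (gibbsProb (interpHam (pairCoef (cavCoef N β) t)
        (pairCoef (fieldCoef N β) t) s G)) (fun ρ : Fin 1 → Config N × Config N => f (ρ 0)) =
      gibbsTS1 N β t s (fun p => G (.inl p)) (fun p => G (.inr (.inl p)))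
        (fun p => G (.inr (.inr p))) f := by
    intro G
    rw [replicaAvg_one]
    unfold gibbsProb gibbsTS1 wTS
    simp only [interpHam_pairCoef hN]
    rw [Finset.sum_div]
    exact Finset.sum_congr rfl fun ρ _ => by ring
  have hmp := measurePreserving_disM3 N
  unfold EgibbsTS1
  rw [← hmp.map_eq, integral_map hmp.measurable.aemeasurable]
  · unfold interpAvg
    simp only [hpt]
  · have hc : Measurable fun ω : (Fin N × Fin N → ℝ) × (Fin N × Fin N → ℝ) ×
        (Fin N × Fin N → ℝ) => gibbsTS1 N β t s ω.1 ω.2.1 ω.2.2 f := by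
      unfold gibbsTS1 wTS
      simp only [hamTS, hamCav_eq_sum, cavField_eq_sum hN]
      fun_prop
    exact hc.aestronglyMeasurable

/-- A fourth power of a normalized sum over sites is a positive-definite kernel. -/
lemma pow_four_div_eq_sum {N : ℕ} (F : Finset (Fin N)) (σ τ : Config N) :
    ((∑ i ∈ F, spin (σ i) * spin (τ i)) / N) ^ 4 =
      ∑ A ∈ Fintype.piFinset fun _ : Fin 4 => F,
        ((∏ k, spin (σ (A k))) / (N : ℝ) ^ 2) * ((∏ k, spin (τ (A k))) / (N : ℝ) ^ 2) := by
  rw [div_pow, Finset.sum_pow', Finset.sum_div]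
  refine Finset.sum_congr rfl fun A _ => ?_
  rw [Finset.prod_mul_distrib, div_mul_div_comm, ← pow_add]

lemma gibbs2_eq_replicaAvg {N : ℕ} (β : ℝ) (g : Fin N × Fin N → ℝ)
    (f : Config N → Config N → ℝ) :
    gibbs2 N β g f = replicaAvg (gibbsProb (ham N β g)) (fun ρ : Fin 2 → Config N =>
      f (ρ 0) (ρ 1)) := by
  rw [replicaAvg_two]
  unfold gibbs2 gibbsProb partFun
  simp only [Finset.sum_div, Real.exp_add]
  refine Finset.sum_congr rfl fun σ _ => Finset.sum_congr rfl fun τ _ => ?_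
  rw [div_mul_div_comm, sq, mul_div_assoc]

lemma continuous_gibbs2 {N : ℕ} (β : ℝ) (f : Config N → Config N → ℝ) :
    Continuous fun g => gibbs2 N β g f := by
  have h : ∀ g, ham N β g =
      interpHam (fun σ p => cavCoef N β σ p + fieldCoef N β σ p) (fun _ _ => 0) 0 g := by
    intro g
    funext σ
    simp [ham_eq_sum, interpHam]
  simp only [gibbs2_eq_replicaAvg, h]
  exact continuous_replicaAvg_interpHam _ _ _ _

lemma integrable_gibbs2 {N : ℕ} (β : ℝ) (f : Config N → Config N → ℝ) :
    Integrable (fun g => gibbs2 N β g f) (gaussPi N) := by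
  refine Integrable.of_bound (continuous_gibbs2 β f).aestronglyMeasurable
    (∑ ρ : Fin 2 → Config N, |f (ρ 0) (ρ 1)|) (ae_of_all _ fun g => ?_)
  rw [gibbs2_eq_replicaAvg]
  exact abs_replicaAvg_le_sum (gibbsProb_nonneg _) (sum_gibbsProb _) _

lemma Egibbs2_ovlpm_pow_four_le (N : ℕ) (β : ℝ) :
    Egibbs2 N β (fun σ τ => ovlpm N σ τ ^ 4) ≤ Egibbs2 N β (fun σ τ => ovlp N σ τ ^ 4) := by
  refine integral_mono (integrable_gibbs2 β _) (integrable_gibbs2 β _) fun g => ?_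
  simp only [gibbs2_eq_replicaAvg, ovlpm, ovlp, pow_four_div_eq_sum]
  rw [replicaAvg_sum, replicaAvg_sum]
  refine Finset.sum_le_sum_of_subset_of_nonneg
    (Fintype.piFinset_subset _ _ fun _ => Finset.filter_subset _ _) fun A _ _ => ?_
  rw [replicaAvg_mul_of_ne (sum_gibbsProb _) (zero_ne_one (α := Fin 2))
    (fun σ : Config N => (∏ k, spin (σ (A k))) / (N : ℝ) ^ 2)
    (fun σ : Config N => (∏ k, spin (σ (A k))) / (N : ℝ) ^ 2)]
  exact mul_self_nonneg _

lemma Egibbs2_nonneg (N : ℕ) (β : ℝ) {f : Config N → Config N → ℝ} (hf : ∀ σ τ, 0 ≤ f σ τ) :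
    0 ≤ Egibbs2 N β f := by
  refine integral_nonneg fun g => div_nonneg ?_ (sq_nonneg _)
  exact Finset.sum_nonneg fun σ _ => Finset.sum_nonneg fun τ _ =>
    mul_nonneg (hf σ τ) (Real.exp_pos _).le

/-- At `s = 1` each component of the coupled system is a copy of the SK system. -/
lemma interpAvg_one_pairComp {N : ℕ} (hN : 0 < N) (β : ℝ) {t : ℝ} (ht : t ∈ Set.Icc (0 : ℝ) 1)
    (r : Config N → Config N → ℝ) (c : Bool) :
    interpAvg (pairCoef (cavCoef N β) t) (pairCoef (fieldCoef N β) t) 1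
      (fun ρ : Fin 2 → Config N × Config N => r (pairComp c (ρ 0)) (pairComp c (ρ 1))) =
      Egibbs2 N β r := by
  have hpt : ∀ G : (Fin N × Fin N) ⊕ (Fin N × Fin N) ⊕ (Fin N × Fin N) → ℝ,
      replicaAvg (gibbsProb (interpHam (pairCoef (cavCoef N β) t)
        (pairCoef (fieldCoef N β) t) 1 G)) (fun ρ : Fin 2 → Config N × Config N =>
          r (pairComp c (ρ 0)) (pairComp c (ρ 1))) =
      gibbs2 N β (fun p => Real.sqrt t * G (.inl p) +
        Real.sqrt (1 - t) * if c then G (.inr (.inl p)) else G (.inr (.inr p))) r := by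
    intro G
    rw [gibbsProb_interpHam_pairCoef hN, gibbs2_eq_replicaAvg,
      replicaAvg_two _ (fun x y => r (pairComp c x) (pairComp c y)), replicaAvg_two]
    simp only [funext (hamTS_one hN β t _ _), Fintype.sum_prod_type]
    set p₁ := gibbsProb (ham N β fun p =>
      Real.sqrt t * G (.inl p) + Real.sqrt (1 - t) * G (.inr (.inl p))) with hp₁
    set p₂ := gibbsProb (ham N β fun p =>
      Real.sqrt t * G (.inl p) + Real.sqrt (1 - t) * G (.inr (.inr p))) with hp₂
    have h₁ : ∑ x, p₁ x = 1 := sum_gibbsProb _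
    have h₂ : ∑ x, p₂ x = 1 := sum_gibbsProb _
    cases c
    · simp only [pairComp, Bool.false_eq_true, if_false]
      rw [← hp₂, Finset.sum_comm]
      refine Finset.sum_congr rfl fun x _ => ?_
      calc ∑ w, ∑ z, ∑ y, r x y * (p₁ w * p₂ x * (p₁ z * p₂ y))
          = ∑ w, p₁ w * ∑ z, p₁ z * ∑ y, r x y * (p₂ x * p₂ y) := by
            simp only [Finset.mul_sum]
            exact Finset.sum_congr rfl fun w _ => Finset.sum_congr rfl fun z _ =>
              Finset.sum_congr rfl fun y _ => by ring
        _ = _ := by simp only [← Finset.sum_mul, h₁, one_mul]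
    · simp only [pairComp, if_true]
      rw [← hp₁]
      refine Finset.sum_congr rfl fun x _ => ?_
      calc ∑ w, ∑ y, ∑ z, r x y * (p₁ x * p₂ w * (p₁ y * p₂ z))
          = ∑ w, p₂ w * ∑ y, r x y * (p₁ x * p₁ y) * ∑ z, p₂ z := by
            simp only [Finset.mul_sum]
            exact Finset.sum_congr rfl fun w _ => Finset.sum_congr rfl fun y _ =>
              Finset.sum_congr rfl fun z _ => by ring
        _ = _ := by simp only [h₂, mul_one, ← Finset.sum_mul, one_mul]
  have hab : Real.sqrt t ^ 2 + Real.sqrt (1 - t) ^ 2 = 1 := by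
    rw [Real.sq_sqrt ht.1, Real.sq_sqrt (sub_nonneg.2 ht.2)]; ring
  have hsel : MeasurePreserving (fun ω : (Fin N × Fin N → ℝ) × (Fin N × Fin N → ℝ) ×
      (Fin N × Fin N → ℝ) => (ω.1, if c then ω.2.1 else ω.2.2)) (disM3 N)
      ((gaussPi N).prod (gaussPi N)) := by
    cases c
    · exact (MeasurePreserving.id (gaussPi N)).prod
        (measurePreserving_snd (μ := gaussPi N) (ν := gaussPi N))
    · exact (MeasurePreserving.id (gaussPi N)).prod
        (measurePreserving_fst (μ := gaussPi N) (ν := gaussPi N))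
  have hmp := (measurePreserving_gaussian_combination (ι := Fin N × Fin N) hab).comp
    (hsel.comp (measurePreserving_disM3 N))
  unfold Egibbs2
  rw [gaussPi, ← hmp.map_eq, integral_map hmp.measurable.aemeasurable
    (continuous_gibbs2 β r).aestronglyMeasurable]
  unfold interpAvg
  simp only [hpt]
  cases c <;> rfl

lemma sum_pairCoef_fieldCoef {N : ℕ} (hN : 0 < N) (β : ℝ) {t : ℝ} (ht : t ∈ Set.Icc (0 : ℝ) 1)
    (ρ ρ' : Config N × Config N) :
    ∑ k, pairCoef (fieldCoef N β) t ρ k * pairCoef (fieldCoef N β) t ρ' k =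
      β ^ 2 * (spinLast ρ.1 * spinLast ρ'.1 * ovlpm N ρ.1 ρ'.1 +
        spinLast ρ.2 * spinLast ρ'.2 * ovlpm N ρ.2 ρ'.2 +
        t * (spinLast ρ.1 * spinLast ρ'.2 * ovlpm N ρ.1 ρ'.2 +
          spinLast ρ.2 * spinLast ρ'.1 * ovlpm N ρ.2 ρ'.1)) := by
  rw [sum_pairCoef_mul_pairCoef _ _ ht]
  simp only [sum_fieldCoef_mul_fieldCoef hN]
  ring

lemma abs_mul_four_term_le {b t w x y z m : ℝ} (hb : 0 ≤ b) (hb1 : b ≤ 1) (ht : 0 ≤ t)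
    (ht1 : t ≤ 1) (hw : |w| ≤ m) (hx : |x| ≤ m) (hy : |y| ≤ m) (hz : |z| ≤ m) :
    |b * (w + x + t * (y + z))| ≤ 4 * m := by
  have h1 : |t * (y + z)| ≤ |y| + |z| := by
    rw [abs_mul, abs_of_nonneg ht]
    exact (mul_le_of_le_one_left (abs_nonneg _) ht1).trans (abs_add_le y z)
  have h2 := abs_add_le (w + x) (t * (y + z))
  have h3 := abs_add_le w x
  rw [abs_mul, abs_of_nonneg hb]
  refine (mul_le_of_le_one_left (abs_nonneg _) hb1).trans ?_
  linarith

/-- The absolute truncated overlap between two distinct components of replicated pairs, set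
to zero on the diagonal. -/
def compOvlp {N n : ℕ} (ρ : Fin n → Config N × Config N) (q q' : Fin n × Bool) : ℝ :=
  if q = q' then 0 else |ovlpm N (pairComp q.2 (ρ q.1)) (pairComp q'.2 (ρ q'.1))|

lemma compOvlp_nonneg {N n : ℕ} (ρ : Fin n → Config N × Config N) (q q' : Fin n × Bool) :
    0 ≤ compOvlp ρ q q' := by
  unfold compOvlp; split_ifs <;> positivity

lemma abs_spinLast_mul_ovlpm_le_sum {N n : ℕ} (ρ : Fin n → Config N × Config N)
    {q q' : Fin n × Bool} (h : q ≠ q') :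
    |spinLast (pairComp q.2 (ρ q.1)) * spinLast (pairComp q'.2 (ρ q'.1)) *
      ovlpm N (pairComp q.2 (ρ q.1)) (pairComp q'.2 (ρ q'.1))| ≤
      ∑ z : (Fin n × Bool) × (Fin n × Bool), compOvlp ρ z.1 z.2 := by
  refine (abs_spinLast_mul_ovlpm_le _ _).trans ?_
  have := Finset.single_le_sum (f := fun z : (Fin n × Bool) × (Fin n × Bool) =>
    compOvlp ρ z.1 z.2) (fun z _ => compOvlp_nonneg ρ z.1 z.2) (Finset.mem_univ (q, q'))
  simpa only [compOvlp, if_neg h] using this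

lemma abs_cov_sub_le {N n : ℕ} (hN : 0 < N) {β t : ℝ} (hβ : β ∈ Set.Ioc (0 : ℝ) 1)
    (ht : t ∈ Set.Icc (0 : ℝ) 1) (ρ : Fin n → Config N × Config N) (i j : Fin n) :
    |∑ k, pairCoef (fieldCoef N β) t (ρ i) k * pairCoef (fieldCoef N β) t (ρ j) k -
      if i = j then β ^ 2 * (2 *
        (#(Finset.univ.filter fun i : Fin N => (i : ℕ) < N - 1) / (N : ℝ))) else 0| ≤
      4 * ∑ z : (Fin n × Bool) × (Fin n × Bool), compOvlp ρ z.1 z.2 := by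
  have hb : 0 ≤ β ^ 2 := sq_nonneg β
  have hb1 : β ^ 2 ≤ 1 := pow_le_one₀ hβ.1.le hβ.2
  have hm := @abs_spinLast_mul_ovlpm_le_sum N n ρ
  rw [sum_pairCoef_fieldCoef hN β ht]
  have h12 := hm (q := (i, true)) (q' := (j, false)) (by simp)
  have h21 := hm (q := (i, false)) (q' := (j, true)) (by simp)
  simp only [pairComp, if_true, Bool.false_eq_true, if_false] at h12 h21
  by_cases hij : i = j
  · subst hij
    rw [if_pos rfl, spinLast_mul_self hN, spinLast_mul_self hN, ovlpm_self, ovlpm_self]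
    have h0 : |(0 : ℝ)| ≤ ∑ z : (Fin n × Bool) × (Fin n × Bool), compOvlp ρ z.1 z.2 := by
      rw [abs_zero]
      exact Finset.sum_nonneg fun z _ => compOvlp_nonneg ρ z.1 z.2
    have h := abs_mul_four_term_le hb hb1 ht.1 ht.2 h0 h0 h12 h21
    convert h using 2
    ring
  · have h11 := hm (q := (i, true)) (q' := (j, true)) (by simp [hij])
    have h22 := hm (q := (i, false)) (q' := (j, false)) (by simp [hij])
    simp only [pairComp, if_true, Bool.false_eq_true, if_false] at h11 h22
    rw [if_neg hij, sub_zero]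
    exact abs_mul_four_term_le hb hb1 ht.1 ht.2 h11 h22 h12 h21

lemma interpAvg_compOvlp_pow_four_le {N : ℕ} (hN : 0 < N) (β t s : ℝ) {n : ℕ}
    (q q' : Fin n × Bool) :
    interpAvg (pairCoef (cavCoef N β) t) (pairCoef (fieldCoef N β) t) s
        (fun ρ : Fin n → Config N × Config N => compOvlp ρ q q' ^ 4) ≤
      interpAvg (pairCoef (cavCoef N β) t) (pairCoef (fieldCoef N β) t) s
        (fun ρ : Fin 2 → Config N × Config N =>
          ∑ c : Bool, ovlpm N (pairComp c (ρ 0)) (pairComp c (ρ 1)) ^ 4) := by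
  unfold interpAvg
  refine integral_mono (integrable_replicaAvg_interpHam _ _ s _)
    (integrable_replicaAvg_interpHam _ _ s _) fun G => ?_
  by_cases h : q = q'
  · simp only [compOvlp, if_pos h]
    have h0 : replicaAvg (gibbsProb (interpHam (pairCoef (cavCoef N β) t)
        (pairCoef (fieldCoef N β) t) s G)) (fun _ : Fin n → Config N × Config N => (0 : ℝ) ^ 4) =
        0 := by simp [replicaAvg]
    rw [h0]
    refine Finset.sum_nonneg fun ρ _ => mul_nonneg ?_ (Finset.prod_nonneg fun _ _ =>
      gibbsProb_nonneg _ _)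
    exact Finset.sum_nonneg fun c _ => Even.pow_nonneg (by decide) _
  · simp only [compOvlp, if_neg h, Even.pow_abs (by decide : Even 4)]
    rw [gibbsProb_interpHam_pairCoef hN]
    exact replicaAvg_kernel_le (sum_gibbsProb _) (sum_gibbsProb _) _ _
      (fun σ τ => pow_four_div_eq_sum _ σ τ) h

/-- third `s`-derivative bound for `f₁(ρ) = σ_N τ_N R⁻(σ,τ)`:
`|∂³/∂s³ E⟨f₁⟩_{t,s}| ≤ K·E⟨R(σ¹,σ²)⁴⟩`. -/
theorem sk_third_derivative_bound :
    ∃ K : ℝ, 0 < K ∧ ∀ N : ℕ, 1 ≤ N → ∀ β ∈ Set.Ioc (0 : ℝ) 1,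
      ∀ t ∈ Set.Icc (0 : ℝ) 1, ∀ s ∈ Set.Icc (0 : ℝ) 1,
      |iteratedDeriv 3 (fun s' => EgibbsTS1 N β t s'
          (fun ρ => spinLast ρ.1 * spinLast ρ.2 * ovlpm N ρ.1 ρ.2)) s| ≤
        K * Egibbs2 N β (fun σ τ => ovlp N σ τ ^ 4) := by
  refine ⟨5760 * 4 ^ 4 * 196 ^ 4 * (Real.exp 48 * 2), by positivity, ?_⟩
  intro N hN β hβ t ht s hs
  have hE0 : 0 ≤ Egibbs2 N β (fun σ τ => ovlp N σ τ ^ 4) :=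
    Egibbs2_nonneg N β fun σ τ => Even.pow_nonneg (by decide) _
  rcases hs.1.eq_or_lt with rfl | hs0
  · rw [iteratedDeriv_three_eq_zero_of_Iic (c := EgibbsTS1 N β t 0
      (fun ρ => spinLast ρ.1 * spinLast ρ.2 * ovlpm N ρ.1 ρ.2))]
    · rw [abs_zero]; positivity
    · intro s hs
      simp only [EgibbsTS1, gibbsTS1, wTS, hamTS, Real.sqrt_eq_zero_of_nonpos hs, Real.sqrt_zero]
  set A := pairCoef (cavCoef N β) t with hA
  set B := pairCoef (fieldCoef N β) t with hB
  have hAB : ∀ ρ ρ', ∑ k, A ρ k * B ρ' k = 0 := by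
    intro ρ ρ'
    rw [hA, hB, sum_pairCoef_mul_pairCoef _ _ ht]
    simp only [sum_cavCoef_mul_fieldCoef]
    ring
  set f : (Fin 1 → Config N × Config N) → ℝ :=
    fun ρ => spinLast (ρ 0).1 * spinLast (ρ 0).2 * ovlpm N (ρ 0).1 (ρ 0).2 with hf
  set h₂ : (Fin 2 → Config N × Config N) → ℝ :=
    fun ρ => ∑ c : Bool, ovlpm N (pairComp c (ρ 0)) (pairComp c (ρ 1)) ^ 4 with hh₂
  have hderiv : iteratedDeriv 3 (fun s' => EgibbsTS1 N β t s'
      (fun ρ => spinLast ρ.1 * spinLast ρ.2 * ovlpm N ρ.1 ρ.2)) s =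
      interpAvg A B s (replicaLaplace B (replicaLaplace B (replicaLaplace B f))) := by
    simp only [EgibbsTS1_eq_interpAvg hN]
    exact iteratedDeriv_three_eq_of_hasDerivAt (fun s hs => hasDerivAt_interpAvg hAB hs f)
      (fun s hs => hasDerivAt_interpAvg hAB hs _) (fun s hs => hasDerivAt_interpAvg hAB hs _) hs0
  have hpt : ∀ ρ : Fin 7 → Config N × Config N,
      |replicaLaplace B (replicaLaplace B (replicaLaplace B f)) ρ| ≤
      5760 * 4 ^ 4 * 196 ^ 3 *
        ∑ z : (Fin 7 × Bool) × (Fin 7 × Bool), compOvlp ρ z.1 z.2 ^ 4 := by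
    intro ρ
    set m := ∑ z : (Fin 7 × Bool) × (Fin 7 × Bool), compOvlp ρ z.1 z.2 with hm
    have hm0 : 0 ≤ m := Finset.sum_nonneg fun z _ => compOvlp_nonneg ρ z.1 z.2
    have hfm : |f (fun _ => ρ 6)| ≤ 4 * m := by
      have := abs_spinLast_mul_ovlpm_le_sum ρ (q := (6, true)) (q' := (6, false)) (by simp)
      simp only [pairComp, if_true, Bool.false_eq_true, if_false] at this
      simp only [hf]
      linarith
    have h1 := abs_replicaLaplace_iterate_le B _ (by positivity) f ρ
      (abs_cov_sub_le hN hβ ht ρ) hfm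
    have h2 := pow_sum_le_card_mul_sum_pow (s := Finset.univ)
      (f := fun z : (Fin 7 × Bool) × (Fin 7 × Bool) => compOvlp ρ z.1 z.2)
      (fun z _ => compOvlp_nonneg ρ z.1 z.2) 3
    have hcard : ((#(Finset.univ : Finset ((Fin 7 × Bool) × (Fin 7 × Bool))) : ℕ) : ℝ) = 196 := by
      simp
    rw [hcard] at h2
    calc _ ≤ 5760 * (4 * m) ^ 4 := h1
      _ = 5760 * 4 ^ 4 * m ^ 4 := by ring
      _ ≤ 5760 * 4 ^ 4 * (196 ^ 3 * ∑ z : (Fin 7 × Bool) × (Fin 7 × Bool),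
          compOvlp ρ z.1 z.2 ^ 4) := mul_le_mul_of_nonneg_left h2 (by norm_num)
      _ = _ := by ring
  have hcov : ∀ x y, |∑ k, B x k * B y k| ≤ 4 := by
    intro x y
    have h := fun σ τ : Config N =>
      (abs_spinLast_mul_ovlpm_le σ τ).trans (abs_ovlpm_le hN σ τ)
    rw [hB, sum_pairCoef_fieldCoef hN β ht]
    exact (abs_mul_four_term_le (sq_nonneg β) (pow_le_one₀ hβ.1.le hβ.2) ht.1 ht.2 (h _ _)
      (h _ _) (h _ _) (h _ _)).trans (by norm_num)
  have hgron : interpAvg A B s h₂ ≤ Real.exp 48 * interpAvg A B 1 h₂ := by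
    have := interpAvg_le_exp_mul hAB hcov (f := h₂)
      (fun ρ => Finset.sum_nonneg fun c _ => Even.pow_nonneg (by decide) _) hs0 hs.2
    norm_num at this
    exact this
  have hone : interpAvg A B 1 h₂ ≤ 2 * Egibbs2 N β (fun σ τ => ovlp N σ τ ^ 4) := by
    rw [hh₂, interpAvg_sum]
    simp only [hA, hB, interpAvg_one_pairComp hN β ht (fun σ τ => ovlpm N σ τ ^ 4),
      Finset.sum_const, Finset.card_univ, Fintype.card_bool, nsmul_eq_mul, Nat.cast_ofNat]
    exact mul_le_mul_of_nonneg_left (Egibbs2_ovlpm_pow_four_le N β) (by norm_num)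
  rw [hderiv]
  calc |interpAvg A B s (replicaLaplace B (replicaLaplace B (replicaLaplace B f)))|
      ≤ interpAvg A B s (fun ρ : Fin 7 → Config N × Config N => 5760 * 4 ^ 4 * 196 ^ 3 *
          ∑ z : (Fin 7 × Bool) × (Fin 7 × Bool), compOvlp ρ z.1 z.2 ^ 4) :=
        (abs_interpAvg_le A B s _).trans (interpAvg_mono A B s hpt)
    _ = 5760 * 4 ^ 4 * 196 ^ 3 * ∑ z : (Fin 7 × Bool) × (Fin 7 × Bool),
          interpAvg A B s (fun ρ => compOvlp ρ z.1 z.2 ^ 4) := by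
        rw [interpAvg_const_mul, interpAvg_sum]
    _ ≤ 5760 * 4 ^ 4 * 196 ^ 3 * ∑ _z : (Fin 7 × Bool) × (Fin 7 × Bool), interpAvg A B s h₂ :=
        mul_le_mul_of_nonneg_left (Finset.sum_le_sum fun z _ =>
          interpAvg_compOvlp_pow_four_le hN β t s z.1 z.2) (by norm_num)
    _ = 5760 * 4 ^ 4 * 196 ^ 4 * interpAvg A B s h₂ := by
        simp only [Finset.sum_const, Finset.card_univ, Fintype.card_prod, Fintype.card_fin,
          Fintype.card_bool, nsmul_eq_mul]
        push_cast
        ring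
    _ ≤ 5760 * 4 ^ 4 * 196 ^ 4 * (Real.exp 48 *
          (2 * Egibbs2 N β (fun σ τ => ovlp N σ τ ^ 4))) :=
        mul_le_mul_of_nonneg_left (hgron.trans (mul_le_mul_of_nonneg_left hone
          (Real.exp_pos _).le)) (by norm_num)
    _ = _ := by ring

end
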